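/- Let X and Y be independent identically distributed random vectors in ℝⁿ with log-concave densities. Then 2 ≤ H(X−Y)/H(X) ≤ e², where H(W) = e^{2h(W)/n} is the entropy power. -/

import Mathlib

open MeasureTheory Real


open Set Filter Topology ENNReal in
lemma cdf_aux (f : ℝ → ℝ) (hf : Continuous f) (hpos : ∀ x, 0 < f x) (hfi0 : Integrable f) :
    (∀ x, HasDerivAt (fun x => ∫ t in Iic x, f t) (f x) x) ∧
    StrictMono (fun x => ∫ t in Iic x, f t) ∧
    range (fun x => ∫ t in Iic x, f t) = Ioo 0 (∫ t, f t) := by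
  have hd : ∀ x, HasDerivAt (fun x => ∫ t in Iic x, f t) (f x) x := by
    intro x
    have h : (fun x => ∫ t in Iic x, f t) = fun x => (∫ t in Iic 0, f t) + ∫ t in (0:ℝ)..x, f t := by
      ext x
      rw [← intervalIntegral.integral_Iic_sub_Iic hfi0.integrableOn hfi0.integrableOn]
      ring
    rw [h]
    exact (intervalIntegral.integral_hasDerivAt_right (hfi0.intervalIntegrable)
      (hf.stronglyMeasurableAtFilter _ _) hf.continuousAt).const_add _
  have hm : StrictMono (fun x => ∫ t in Iic x, f t) :=
    strictMono_of_hasDerivAt_pos hd hpos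
  have hbot : Tendsto (fun x => ∫ t in Iic x, f t) atBot (𝓝 0) := by
    have h : (fun x => ∫ t in Iic x, f t) = fun x => (∫ t in Iic 0, f t) - ∫ t in x..(0:ℝ), f t := by
      ext x
      rw [← intervalIntegral.integral_Iic_sub_Iic hfi0.integrableOn hfi0.integrableOn]
      ring
    rw [h]
    have := (intervalIntegral_tendsto_integral_Iic (0:ℝ) hfi0.integrableOn tendsto_id).const_sub
      (∫ t in Iic 0, f t)
    simpa using this
  have htop : Tendsto (fun x => ∫ t in Iic x, f t) atTop (𝓝 (∫ t, f t)) := by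
    have h : (fun x => ∫ t in Iic x, f t) = fun x => (∫ t in Iic 0, f t) + ∫ t in (0:ℝ)..x, f t := by
      ext x
      rw [← intervalIntegral.integral_Iic_sub_Iic hfi0.integrableOn hfi0.integrableOn]
      ring
    rw [h]
    have := (intervalIntegral_tendsto_integral_Ioi (0:ℝ) hfi0.integrableOn tendsto_id).const_add
      (∫ t in Iic 0, f t)
    rw [intervalIntegral.integral_Iic_add_Ioi hfi0.integrableOn hfi0.integrableOn] at this
    simpa using this
  refine ⟨hd, hm, ?_⟩
  have hc : Continuous (fun x => ∫ t in Iic x, f t) :=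
    continuous_iff_continuousAt.2 fun x => (hd x).continuousAt
  apply Subset.antisymm
  · rintro _ ⟨x, rfl⟩
    constructor
    · exact lt_of_le_of_lt (le_of_tendsto hbot (eventually_atBot.2 ⟨x - 1, fun y hy => hm.monotone hy⟩))
        (hm (by linarith : x - 1 < x))
    · exact lt_of_lt_of_le (hm (by linarith : x < x + 1))
        (ge_of_tendsto htop (eventually_atTop.2 ⟨x + 1, fun y hy => hm.monotone hy⟩))
  · rintro y ⟨h0, h1⟩
    obtain ⟨a, ha⟩ := (hbot.eventually (gt_mem_nhds h0)).exists
    obtain ⟨b, hb⟩ := (htop.eventually (lt_mem_nhds h1)).exists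
    exact mem_range_of_exists_le_of_exists_ge hc ⟨a, ha.le⟩ ⟨b, hb.le⟩

open Set Filter Topology ENNReal in
lemma transport_exists (f F : ℝ → ℝ) (hf : Continuous f) (hpos : ∀ x, 0 < f x)
    (hfi0 : Integrable f) (hF : Continuous F) (hFpos : ∀ x, 0 < F x) (hFint : Integrable F)
    (c : ℝ) (hc : 0 < c) (h : ∫ x, f x = c * ∫ x, F x) :
    ∃ T T' : ℝ → ℝ, (∀ x, HasDerivAt T (T' x) x) ∧ (∀ x, 0 < T' x) ∧ Function.Surjective T ∧
      Continuous T' ∧ ∀ x, f (T x) * T' x = c * F x := by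
  obtain ⟨d1, m1, r1⟩ := cdf_aux f hf hpos hfi0
  obtain ⟨d2, m2, r2⟩ := cdf_aux F hF hFpos hFint
  set A := fun x => ∫ t in Iic x, f t with hA
  set B := fun x => ∫ t in Iic x, F t with hB
  have ex : ∀ x, ∃ y, A y = c * B x := by
    intro x
    have : B x ∈ Ioo 0 (∫ t, F t) := r2 ▸ mem_range_self x
    have h2 : c * B x ∈ Ioo 0 (∫ t, f t) := by
      rw [h]; exact ⟨mul_pos hc this.1, mul_lt_mul_of_pos_left this.2 hc⟩
    rw [← r1] at h2
    exact h2
  choose T hT using ex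
  have hTm : StrictMono T := by
    intro x y hxy
    rw [← m1.lt_iff_lt, hT, hT]
    exact mul_lt_mul_of_pos_left (m2 hxy) hc
  have hTs : Function.Surjective T := by
    intro y
    have : A y ∈ Ioo 0 (∫ t, f t) := r1 ▸ mem_range_self y
    have h2 : A y / c ∈ Ioo 0 (∫ t, F t) := by
      rw [h] at this
      exact ⟨div_pos this.1 hc, by rw [div_lt_iff₀ hc]; linarith [this.2]⟩
    rw [← r2] at h2
    obtain ⟨x, hx⟩ := h2
    refine ⟨x, m1.injective ?_⟩
    rw [hT]
    have : B x = A y / c := hx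
    rw [this]; field_simp
  have hTc : Continuous T := hTm.monotone.continuous_of_surjective hTs
  refine ⟨T, fun x => c * F x / f (T x), ?_, ?_, hTs, ?_, ?_⟩
  · intro x
    have hs : HasDerivAt (fun y => A y / c) (f (T x) / c) (T x) := (d1 (T x)).div_const c
    obtain ⟨S, hS1, hS2⟩ : ∃ S : ℝ → ℝ, (∀ y, S (B y) = T y) ∧ ContinuousAt S (B x) := by
      refine ⟨fun z => T (Function.invFun B z), fun y => ?_, ?_⟩
      · simp [Function.leftInverse_invFun m2.injective y]
      · apply hTc.continuousAt.comp
        have hi : HasStrictDerivAt B (F x) x := by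
          apply hasStrictDerivAt_of_hasDerivAt_of_continuousAt (f' := F)
          · exact Eventually.of_forall d2
          · exact hF.continuousAt
        have : (hi.localInverse B (F x) x (hFpos x).ne') =ᶠ[𝓝 (B x)] Function.invFun B := by
          filter_upwards [hi.eventually_right_inverse (hFpos x).ne'] with z hz
          conv_rhs => rw [← hz]
          rw [Function.leftInverse_invFun m2.injective]
        exact ((hi.to_localInverse (hFpos x).ne').hasDerivAt.continuousAt).congr this
    have hS : HasDerivAt S (f (T x) / c)⁻¹ (B x) := by
      apply HasDerivAt.of_local_left_inverse (f := fun y => A y / c) hS2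
      · rw [hS1]; exact hs
      · exact (div_pos (hpos _) hc).ne'
      · have : range B ∈ 𝓝 (B x) := by
          rw [r2]; exact isOpen_Ioo.mem_nhds (r2 ▸ mem_range_self x)
        filter_upwards [this]
        rintro _ ⟨y, rfl⟩
        rw [hS1, hT]; field_simp
    have := hS.comp x (d2 x)
    have h1 : S ∘ B = T := funext hS1
    have h2 : (f (T x) / c)⁻¹ * F x = c * F x / f (T x) := by
      have := (hpos (T x)).ne'
      field_simp
    rw [h1, h2] at this
    exact this
  · intro x; exact div_pos (mul_pos hc (hFpos x)) (hpos _)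
  · exact (continuous_const.mul hF).div (hf.comp hTc) fun x => (hpos _).ne'
  · intro x; field_simp [(hpos (T x)).ne']

open Set Filter Topology ENNReal in
lemma lintegral_comp_smul_aux {E : Type*} [NormedAddCommGroup E] [NormedSpace ℝ E]
    [MeasurableSpace E] [BorelSpace E] [FiniteDimensional ℝ E] (μ : Measure E) [μ.IsAddHaarMeasure]
    (f : E → ℝ≥0∞) (c : ℝ) (hc : 0 < c) :
    ∫⁻ x, f (c • x) ∂μ = (ENNReal.ofReal c ^ Module.finrank ℝ E)⁻¹ * ∫⁻ x, f x ∂μ := by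
  have h := Measure.map_addHaar_smul μ hc.ne'
  have h2 : ∫⁻ x, f x ∂(Measure.map (c • ·) μ) = ∫⁻ x, f (c • x) ∂μ :=
    (measurableEmbedding_const_smul₀ hc.ne').lintegral_map f
  rw [← h2, h, lintegral_smul_measure, abs_of_pos (by positivity),
    ENNReal.ofReal_inv_of_pos (by positivity), ENNReal.ofReal_pow hc.le, smul_eq_mul]


open Set Filter Topology ENNReal in
lemma rot_aux (Φ : ℝ → ℝ → ℝ≥0∞) (hΦ : Measurable (Function.uncurry Φ)) :
    ∫⁻ x, ∫⁻ y, Φ (x - y) (x + y) = 2⁻¹ * ∫⁻ u, ∫⁻ v, Φ u v := by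
  have hm2 : ∀ (a b : ℝ × ℝ → ℝ), Measurable a → Measurable b → Measurable (fun z => Φ (a z) (b z)) :=
    fun a b ha hb => hΦ.comp (ha.prodMk hb)
  rw [lintegral_lintegral_swap (f := fun x y => Φ (x - y) (x + y))
    (hm2 (fun z => z.1 - z.2) (fun z => z.1 + z.2) (by fun_prop) (by fun_prop)).aemeasurable]
  have h1 : ∀ y : ℝ, ∫⁻ x, Φ (x - y) (x + y) = ∫⁻ u, Φ u (u + 2 * y) := by
    intro y
    rw [← lintegral_sub_right_eq_self (fun u => Φ u (u + 2 * y)) y]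
    congr 1; ext x; congr 1; ring
  simp_rw [h1]
  rw [lintegral_lintegral_swap (f := fun y u => Φ u (u + 2 * y))
    (hm2 (fun z => z.2) (fun z => z.2 + 2 * z.1) (by fun_prop) (by fun_prop)).aemeasurable]
  rw [← lintegral_const_mul _ (hΦ.lintegral_prod_right)]
  congr 1; ext u
  have h2 := lintegral_comp_smul_aux (volume : Measure ℝ) (fun v => Φ u (u + v)) (2:ℝ) two_pos
  simp only [smul_eq_mul, Module.finrank_self, pow_one] at h2
  rw [h2, lintegral_add_left_eq_self (fun v => Φ u v) u]
  simp

open Set Filter Topology ENNReal in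
lemma cov_aux (T T' : ℝ → ℝ) (hT : ∀ x, HasDerivAt T (T' x) x) (hT' : ∀ x, 0 < T' x)
    (g : ℝ → ℝ≥0∞) :
    ∫⁻ x, ENNReal.ofReal (T' x) * g (T x) = ∫⁻ x in range T, g x := by
  have hm : StrictMono T := strictMono_of_hasDerivAt_pos hT hT'
  have := lintegral_image_eq_lintegral_abs_deriv_mul MeasurableSet.univ
    (fun x _ => (hT x).hasDerivWithinAt) hm.injective.injOn g
  rw [image_univ] at this
  rw [this]
  simp [abs_of_pos (hT' _)]

/-- The constant in the sharp Young inequality. -/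
noncomputable def yC (r : ℝ) : ENNReal :=
  (∫⁻ x : ℝ, ENNReal.ofReal (exp (-(2 * π * ((r + 1) / (2 * r))) * x ^ 2))) *
  (∫⁻ x : ℝ, ENNReal.ofReal (exp (-(π * (r + 1)) * x ^ 2))) ^ (1 / r)

open Set Filter Topology ENNReal in
lemma young_core (r : ℝ) (hr : 1 < r) (f g : ℝ → ℝ≥0∞) (k : ℝ → ℝ≥0∞)
    (hf : Measurable f) (hg : Measurable g) (hk : Measurable k)
    (T T' S S' : ℝ → ℝ) (hT : ∀ x, HasDerivAt T (T' x) x) (hT' : ∀ x, 0 < T' x)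
    (hTs : Function.Surjective T) (hTc : Continuous T')
    (hS : ∀ x, HasDerivAt S (S' x) x) (hS' : ∀ x, 0 < S' x)
    (hSs : Function.Surjective S) (hSc : Continuous S') (c₁ c₂ : ℝ≥0∞)
    (hfT : ∀ x, f (T x) * ENNReal.ofReal (T' x) = c₁ * ENNReal.ofReal (exp (-π * x ^ 2)))
    (hgS : ∀ x, g (S x) * ENNReal.ofReal (S' x) = c₂ * ENNReal.ofReal (exp (-π * x ^ 2))) :
    ∫⁻ x, ∫⁻ y, f (x - y) ^ ((r + 1) / (2 * r)) * g (x + y) ^ ((r + 1) / (2 * r)) *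
      k y ^ ((r - 1) / r) ≤
    yC r * (c₁ ^ ((r + 1) / (2 * r)) * c₂ ^ ((r + 1) / (2 * r)) * (∫⁻ y, k y) ^ ((r - 1) / r)) := by
  set a := (r + 1) / (2 * r) with ha
  set b := (r - 1) / r with hb
  have hr0 : 0 < r := by linarith
  have ha0 : 0 < a := by positivity
  have hb0 : 0 < b := div_pos (by linarith) hr0
  have hab : 1 - a = b / 2 := by rw [ha, hb]; field_simp; ring
  have hTcont : Continuous T := continuous_iff_continuousAt.2 fun x => (hT x).continuousAt
  have hScont : Continuous S := continuous_iff_continuousAt.2 fun x => (hS x).continuousAt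
  have hTm := hTcont.measurable
  have hSm := hScont.measurable
  have hTm' := hTc.measurable
  have hSm' := hSc.measurable
  let Φ : ℝ → ℝ → ℝ≥0∞ := fun u v => f u ^ a * g v ^ a * k ((v - u) / 2) ^ b
  have hΦ : Measurable (Function.uncurry Φ) := by
    simp only [Φ, Function.uncurry_def]; fun_prop
  let Ψ : ℝ → ℝ → ℝ≥0∞ := fun u v =>
    ENNReal.ofReal (T' u) * (ENNReal.ofReal (S' v) * Φ (T u) (S v))
  have hΨ : Measurable (Function.uncurry Ψ) := by
    simp only [Ψ, Φ, Function.uncurry_def]; fun_prop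
  have e1 : ∫⁻ x, ∫⁻ y, f (x - y) ^ a * g (x + y) ^ a * k y ^ b =
      ∫⁻ x, ∫⁻ y, Φ (x - y) (x + y) := by
    refine lintegral_congr fun x => lintegral_congr fun y => ?_
    simp only [Φ]
    congr 3; ring
  have e2 : ∫⁻ u, ∫⁻ v, Φ u v = ∫⁻ u, ∫⁻ v, Ψ u v := by
    have h1 := cov_aux T T' hT hT' (fun u => ∫⁻ v, Φ u v)
    rw [hTs.range_eq, Measure.restrict_univ] at h1
    rw [← h1]
    refine lintegral_congr fun u => ?_
    have h2 := cov_aux S S' hS hS' (fun v => Φ (T u) v)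
    rw [hSs.range_eq, Measure.restrict_univ] at h2
    rw [← h2, ← lintegral_const_mul _ (by simp only [Φ]; fun_prop)]
  rw [e1, rot_aux Φ hΦ, e2, ← rot_aux Ψ hΨ]
  -- pointwise bound
  have key : ∀ x y, Ψ (x - y) (x + y) ≤ (c₁ ^ a * c₂ ^ a * ENNReal.ofReal (exp (-(2 * π * a) * x ^ 2))) *
      (ENNReal.ofReal (exp (-(2 * π * a) * y ^ 2)) *
        (ENNReal.ofReal ((T' (x - y) + S' (x + y)) / 2) * k ((S (x + y) - T (x - y)) / 2)) ^ b) := by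
    intro x y
    have split : ∀ t : ℝ, 0 < t → ENNReal.ofReal t = ENNReal.ofReal t ^ a * ENNReal.ofReal t ^ (b / 2) := by
      intro t ht
      rw [← ENNReal.rpow_add _ _ (by simpa using ht) ENNReal.ofReal_ne_top, ← hab]
      simp
    have hamgm : ENNReal.ofReal (T' (x - y)) ^ (b / 2) * ENNReal.ofReal (S' (x + y)) ^ (b / 2) ≤
        ENNReal.ofReal ((T' (x - y) + S' (x + y)) / 2) ^ b := by
      rw [← ENNReal.mul_rpow_of_nonneg _ _ (by positivity), ← ENNReal.ofReal_mul (hT' _).le]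
      have : b = 2 * (b / 2) := by ring
      conv_rhs => rw [this, ENNReal.rpow_mul]
      gcongr
      rw [ENNReal.ofReal_rpow_of_pos (by have := hT' (x-y); have := hS' (x+y); positivity)]
      apply ENNReal.ofReal_le_ofReal
      norm_num
      nlinarith [sq_nonneg (T' (x - y) - S' (x + y))]
    have hgauss : ENNReal.ofReal (exp (-π * (x - y) ^ 2)) ^ a * ENNReal.ofReal (exp (-π * (x + y) ^ 2)) ^ a
        = ENNReal.ofReal (exp (-(2 * π * a) * x ^ 2)) * ENNReal.ofReal (exp (-(2 * π * a) * y ^ 2)) := by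
      rw [ENNReal.ofReal_rpow_of_pos (exp_pos _), ENNReal.ofReal_rpow_of_pos (exp_pos _),
        ← ENNReal.ofReal_mul (by positivity), ← ENNReal.ofReal_mul (by positivity),
        ← Real.exp_mul, ← Real.exp_mul, ← Real.exp_add, ← Real.exp_add]
      congr 2; ring
    have h1 : f (T (x - y)) ^ a * ENNReal.ofReal (T' (x - y)) ^ a =
        c₁ ^ a * ENNReal.ofReal (exp (-π * (x - y) ^ 2)) ^ a := by
      rw [← ENNReal.mul_rpow_of_nonneg _ _ ha0.le, hfT, ENNReal.mul_rpow_of_nonneg _ _ ha0.le]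
    have h2 : g (S (x + y)) ^ a * ENNReal.ofReal (S' (x + y)) ^ a =
        c₂ ^ a * ENNReal.ofReal (exp (-π * (x + y) ^ 2)) ^ a := by
      rw [← ENNReal.mul_rpow_of_nonneg _ _ ha0.le, hgS, ENNReal.mul_rpow_of_nonneg _ _ ha0.le]
    calc Ψ (x - y) (x + y) = (f (T (x - y)) ^ a * ENNReal.ofReal (T' (x - y)) ^ a) *
          (g (S (x + y)) ^ a * ENNReal.ofReal (S' (x + y)) ^ a) *
          (ENNReal.ofReal (T' (x - y)) ^ (b / 2) * ENNReal.ofReal (S' (x + y)) ^ (b / 2)) *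
          k ((S (x + y) - T (x - y)) / 2) ^ b := by
            simp only [Ψ, Φ]
            have s1 := split _ (hT' (x - y))
            have s2 := split _ (hS' (x + y))
            generalize ENNReal.ofReal (T' (x - y)) = t at *
            generalize ENNReal.ofReal (S' (x + y)) = s at *
            generalize k ((S (x + y) - T (x - y)) / 2) ^ b = w at *
            nth_rewrite 1 [s1]
            nth_rewrite 1 [s2]
            ring
      _ ≤ (f (T (x - y)) ^ a * ENNReal.ofReal (T' (x - y)) ^ a) *
          (g (S (x + y)) ^ a * ENNReal.ofReal (S' (x + y)) ^ a) *
          (ENNReal.ofReal ((T' (x - y) + S' (x + y)) / 2) ^ b) *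
          k ((S (x + y) - T (x - y)) / 2) ^ b := by gcongr
      _ = _ := by
          rw [h1, h2, ENNReal.mul_rpow_of_nonneg _ _ hb0.le]
          calc _ = c₁ ^ a * c₂ ^ a * (ENNReal.ofReal (exp (-π * (x - y) ^ 2)) ^ a * ENNReal.ofReal (exp (-π * (x + y) ^ 2)) ^ a) * (ENNReal.ofReal ((T' (x - y) + S' (x + y)) / 2) ^ b * k ((S (x + y) - T (x - y)) / 2) ^ b) := by ring
            _ = _ := by rw [hgauss]; ring
  have hconj : r.HolderConjugate (1 / b) := by
    rw [Real.holderConjugate_iff]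
    refine ⟨hr, ?_⟩
    rw [hb]; field_simp; ring
  have inner : ∀ x, ∫⁻ y, Ψ (x - y) (x + y) ≤
      (c₁ ^ a * c₂ ^ a * ENNReal.ofReal (exp (-(2 * π * a) * x ^ 2))) *
      ((∫⁻ y : ℝ, ENNReal.ofReal (exp (-(π * (r + 1)) * y ^ 2))) ^ (1 / r) * (∫⁻ y, k y) ^ b) := by
    intro x
    refine (lintegral_mono (key x)).trans ?_
    rw [lintegral_const_mul _ (by fun_prop)]
    gcongr
    have H := ENNReal.lintegral_mul_le_Lp_mul_Lq volume hconj
      (f := fun y => ENNReal.ofReal (exp (-(2 * π * a) * y ^ 2)))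
      (g := fun y => (ENNReal.ofReal ((T' (x - y) + S' (x + y)) / 2) * k ((S (x + y) - T (x - y)) / 2)) ^ b)
      (by fun_prop) (by fun_prop)
    refine H.trans ?_
    have g1 : ∀ y : ℝ, ENNReal.ofReal (exp (-(2 * π * a) * y ^ 2)) ^ r = ENNReal.ofReal (exp (-(π * (r + 1)) * y ^ 2)) := by
      intro y
      rw [ENNReal.ofReal_rpow_of_pos (exp_pos _), ← Real.exp_mul]
      congr 2; rw [ha]; field_simp
    simp only [g1, ← ENNReal.rpow_mul, mul_one_div_cancel hb0.ne', ENNReal.rpow_one, one_div_one_div]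
    refine mul_le_mul_right (ENNReal.rpow_le_rpow ?_ hb0.le) _
    have hw : ∀ y, HasDerivAt (fun y => (S (x + y) - T (x - y)) / 2) ((T' (x - y) + S' (x + y)) / 2) y := by
      intro y
      have h1 : HasDerivAt (fun y => S (x + y)) (S' (x + y)) y := (hS (x + y)).comp_const_add x y
      have h2 : HasDerivAt (fun y => T (x - y)) (-T' (x - y)) y := (hT (x - y)).comp_const_sub x y
      have h3 := (h1.sub h2).div_const 2
      rw [sub_neg_eq_add, add_comm (S' (x + y))] at h3
      exact h3
    rw [cov_aux _ _ hw (fun y => by have := hT' (x-y); have := hS' (x+y); positivity)]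
    exact setLIntegral_le_lintegral _ _
  refine (lintegral_mono inner).trans ?_
  rw [lintegral_mul_const _ (by fun_prop), lintegral_const_mul _ (by fun_prop)]
  apply le_of_eq
  rw [yC]
  ring


open Set Filter Topology ENNReal in
lemma young_cont (r : ℝ) (hr : 1 < r) (f g : ℝ → ℝ) (k : ℝ → ℝ≥0∞)
    (hf : Continuous f) (hfp : ∀ x, 0 < f x) (hfi : Integrable f)
    (hg : Continuous g) (hgp : ∀ x, 0 < g x) (hgi : Integrable g) (hk : Measurable k) :
    ∫⁻ x, ∫⁻ y, ENNReal.ofReal (f (x - y)) ^ ((r + 1) / (2 * r)) *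
      ENNReal.ofReal (g (x + y)) ^ ((r + 1) / (2 * r)) * k y ^ ((r - 1) / r) ≤
    yC r * ((∫⁻ x, ENNReal.ofReal (f x)) ^ ((r + 1) / (2 * r)) *
      (∫⁻ x, ENNReal.ofReal (g x)) ^ ((r + 1) / (2 * r)) * (∫⁻ y, k y) ^ ((r - 1) / r)) := by
  have hFi : Integrable (fun x : ℝ => exp (-π * x ^ 2)) := integrable_exp_neg_mul_sq pi_pos
  have hF1 : ∫ x : ℝ, exp (-π * x ^ 2) = 1 := by
    rw [integral_gaussian, div_self pi_ne_zero, sqrt_one]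
  have hFc : Continuous (fun x : ℝ => exp (-π * x ^ 2)) := by fun_prop
  have pos : ∀ h : ℝ → ℝ, (∀ x, 0 < h x) → Continuous h → Integrable h → 0 < ∫ x, h x := by
    intro h hp hc hi
    obtain ⟨-, -, h3⟩ := cdf_aux h hc hp hi
    have : (∫ t in Iic (0:ℝ), h t) ∈ Ioo 0 (∫ t, h t) := h3 ▸ mem_range_self (0:ℝ)
    exact this.1.trans this.2
  obtain ⟨T, T', hT, hT', hTs, hTc, hTe⟩ := transport_exists f _ hf hfp hfi hFc (fun x => exp_pos _) hFi
    (∫ x, f x) (pos f hfp hf hfi) (by rw [hF1, mul_one])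
  obtain ⟨S, S', hS, hS', hSs, hSc, hSe⟩ := transport_exists g _ hg hgp hgi hFc (fun x => exp_pos _) hFi
    (∫ x, g x) (pos g hgp hg hgi) (by rw [hF1, mul_one])
  have H := young_core r hr (fun x => ENNReal.ofReal (f x)) (fun x => ENNReal.ofReal (g x)) k
    (by fun_prop) (by fun_prop) hk T T' S S' hT hT' hTs hTc hS hS' hSs hSc
    (ENNReal.ofReal (∫ x, f x)) (ENNReal.ofReal (∫ x, g x)) (fun x => by
      rw [← ENNReal.ofReal_mul (hfp _).le, hTe, ENNReal.ofReal_mul (pos f hfp hf hfi).le])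
    (fun x => by
      rw [← ENNReal.ofReal_mul (hgp _).le, hSe, ENNReal.ofReal_mul (pos g hgp hg hgi).le])
  rw [ofReal_integral_eq_lintegral_ofReal hfi (Eventually.of_forall fun x => (hfp x).le),
    ofReal_integral_eq_lintegral_ofReal hgi (Eventually.of_forall fun x => (hgp x).le)] at H
  exact H

open Set Filter Topology ENNReal in
lemma fatou_aux (a : ℝ) (ha : 0 < a) (φ : ℝ × ℝ → ℝ) (hφ : Measure.QuasiMeasurePreserving φ)
    (m : ℝ × ℝ → ℝ≥0∞) (hm : Measurable m) (fj : ℕ → ℝ → ℝ≥0∞) (f : ℝ → ℝ≥0∞)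
    (hfj : ∀ j, Measurable (fj j)) (hf : Measurable f)
    (hlim : ∀ᵐ x, Tendsto (fun j => fj j x) atTop (𝓝 (f x))) (δ : ℕ → ℝ≥0∞)
    (hδ : Tendsto δ atTop (𝓝 0)) (hfi0 : ∀ j, ∫⁻ x, fj j x ≤ (∫⁻ x, f x) + δ j) (D : ℝ≥0∞)
    (hD : ∀ j, ∫⁻ z, fj j (φ z) ^ a * m z ≤ D * (∫⁻ x, fj j x) ^ a) :
    ∫⁻ z, f (φ z) ^ a * m z ≤ D * (∫⁻ x, f x) ^ a := by
  by_cases h0 : ∫⁻ x, f x = 0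
  · rw [lintegral_eq_zero_iff hf] at h0
    have : ∀ᵐ z, f (φ z) ^ a * m z = 0 := by
      filter_upwards [hφ.ae h0] with z hz
      simp only [Pi.zero_apply] at hz
      rw [hz, ENNReal.zero_rpow_of_pos ha, zero_mul]
    rw [lintegral_congr_ae this]
    simp
  have h1 : ∫⁻ z, f (φ z) ^ a * m z ≤ ∫⁻ z, liminf (fun j => fj j (φ z) ^ a * m z) atTop := by
    apply lintegral_mono_ae
    filter_upwards [hφ.ae hlim] with z hz
    by_cases hz0 : f (φ z) = 0
    · rw [hz0, ENNReal.zero_rpow_of_pos ha, zero_mul]; exact zero_le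
    · apply le_of_eq
      symm
      apply Tendsto.liminf_eq
      apply ENNReal.Tendsto.mul_const
      · exact (ENNReal.continuous_rpow_const.tendsto _).comp hz
      · left
        simp [ENNReal.rpow_eq_zero_iff, hz0, ha.not_gt]
  refine h1.trans ((lintegral_liminf_le fun j => ?_).trans ?_)
  · exact (((hfj j).comp hφ.measurable).pow_const a).mul hm
  have h2 : Tendsto (fun j => D * ((∫⁻ x, f x) + δ j) ^ a) atTop (𝓝 (D * (∫⁻ x, f x) ^ a)) := by
    apply ENNReal.Tendsto.const_mul
    · have : Tendsto (fun j => (∫⁻ x, f x) + δ j) atTop (𝓝 (∫⁻ x, f x)) := by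
        simpa using hδ.const_add (∫⁻ x, f x)
      exact (ENNReal.continuous_rpow_const.tendsto _).comp this
    · left
      simp [ENNReal.rpow_eq_zero_iff, h0, ha.not_gt]
  rw [← h2.liminf_eq]
  refine liminf_le_liminf (Eventually.of_forall fun j => (hD j).trans ?_)
  gcongr
  exact hfi0 j

open Set Filter Topology ENNReal in
lemma approx_aux (f : ℝ → ℝ≥0∞) (hf : Measurable f) (hfi : ∫⁻ x, f x ≠ ∞) :
    ∃ fj : ℕ → ℝ → ℝ, (∀ j, Continuous (fj j)) ∧ (∀ j x, 0 < fj j x) ∧ (∀ j, Integrable (fj j)) ∧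
      (∀ᵐ x, Tendsto (fun j => ENNReal.ofReal (fj j x)) atTop (𝓝 (f x))) ∧
      ∀ j, ∫⁻ x, ENNReal.ofReal (fj j x) ≤ (∫⁻ x, f x) + 2 * 2⁻¹ ^ j := by
  have hi : Integrable (fun x => (f x).toReal) := integrable_toReal_of_lintegral_ne_top hf.aemeasurable hfi
  have hfin : ∀ᵐ x, f x < ∞ := ae_lt_top hf hfi
  have hε : ∀ j : ℕ, (2⁻¹ : ℝ≥0∞) ^ j ≠ 0 := fun j => by simp
  choose g hg1 hg2 hg3 hg4 using fun j : ℕ => hi.exists_hasCompactSupport_lintegral_sub_le (hε j)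
  have hFi : Integrable (fun x : ℝ => exp (-π * x ^ 2)) := integrable_exp_neg_mul_sq pi_pos
  have hF1 : ∫ x : ℝ, exp (-π * x ^ 2) = 1 := by
    rw [integral_gaussian, div_self pi_ne_zero, sqrt_one]
  refine ⟨fun j x => |g j x| + 2⁻¹ ^ j * exp (-π * x ^ 2), fun j => ?_, fun j x => ?_, fun j => ?_, ?_, fun j => ?_⟩
  · have := hg3 j; fun_prop
  · positivity
  · exact (hg4 j).abs.add (hFi.const_mul _)
  · have hs : ∑' j, ∫⁻ x, ‖(f x).toReal - g j x‖ₑ ≠ ∞ := by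
      refine ne_top_of_le_ne_top ?_ (ENNReal.tsum_le_tsum hg2)
      rw [ENNReal.tsum_geometric]
      simp
    rw [← lintegral_tsum (fun j => by have := (hg3 j).measurable; fun_prop)] at hs
    have h1 := ae_lt_top (by
      apply Measurable.tsum
      intro j; have := (hg3 j).measurable; fun_prop) hs
    filter_upwards [h1, hfin] with x hx hx2
    have h2 := ENNReal.tendsto_atTop_zero_of_tsum_ne_top hx.ne
    have h3 : Tendsto (fun j => g j x) atTop (𝓝 (f x).toReal) := by
      rw [tendsto_iff_edist_tendsto_0]
      refine h2.congr fun j => ?_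
      rw [edist_comm, edist_eq_enorm_sub]
    have h4 : Tendsto (fun j : ℕ => |g j x| + 2⁻¹ ^ j * exp (-π * x ^ 2)) atTop (𝓝 (|(f x).toReal| + 0 * exp (-π * x ^ 2))) :=
      h3.abs.add ((_root_.tendsto_pow_atTop_nhds_zero_of_lt_one (by norm_num) (by norm_num)).mul_const _)
    have h5 := ENNReal.tendsto_ofReal h4
    simpa [ENNReal.ofReal_toReal hx2.ne] using h5
  · calc ∫⁻ x, ENNReal.ofReal (|g j x| + 2⁻¹ ^ j * exp (-π * x ^ 2))
        ≤ ∫⁻ x, (f x + ‖(f x).toReal - g j x‖ₑ + 2⁻¹ ^ j * ENNReal.ofReal (exp (-π * x ^ 2))) := by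
          apply lintegral_mono_ae
          filter_upwards [hfin] with x hx
          rw [ENNReal.ofReal_add (by positivity) (by positivity), ENNReal.ofReal_mul (by positivity),
            ENNReal.ofReal_pow (by positivity), ENNReal.ofReal_inv_of_pos (by positivity)]
          simp only [ENNReal.ofReal_ofNat]
          gcongr
          rw [← ofReal_norm]
          have e : ENNReal.ofReal (f x).toReal = f x := ENNReal.ofReal_toReal hx.ne
          nth_rewrite 1 [← e]
          rw [← ENNReal.ofReal_add (by positivity) (by positivity)]
          apply ENNReal.ofReal_le_ofReal
          rw [Real.norm_eq_abs, abs_sub_comm]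
          have := abs_sub_abs_le_abs_sub (g j x) (f x).toReal
          rw [abs_of_nonneg (ENNReal.toReal_nonneg (a := f x))] at this
          linarith
      _ = (∫⁻ x, f x) + (∫⁻ x, ‖(f x).toReal - g j x‖ₑ) + 2⁻¹ ^ j * 1 := by
          have := (hg3 j).measurable
          rw [lintegral_add_left (by fun_prop), lintegral_add_left hf,
            lintegral_const_mul _ (by fun_prop), ← ofReal_integral_eq_lintegral_ofReal hFi
              (Eventually.of_forall fun x => (exp_pos _).le), hF1, ENNReal.ofReal_one]
      _ ≤ _ := by
          rw [mul_one, two_mul, add_assoc]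
          gcongr
          exact hg2 j

open Set Filter Topology ENNReal in
/-- Extension principle: an estimate for nice functions extends to all measurable functions. -/
lemma extend_aux (a : ℝ) (ha : 0 < a) (φ : ℝ × ℝ → ℝ) (hφ : Measure.QuasiMeasurePreserving φ)
    (m : ℝ × ℝ → ℝ≥0∞) (hm : Measurable m) (D : ℝ≥0∞)
    (H : ∀ f : ℝ → ℝ, Continuous f → (∀ x, 0 < f x) → Integrable f →
      ∫⁻ z, ENNReal.ofReal (f (φ z)) ^ a * m z ≤ D * (∫⁻ x, ENNReal.ofReal (f x)) ^ a)
    (f : ℝ → ℝ≥0∞) (hf : Measurable f) :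
    ∫⁻ z, f (φ z) ^ a * m z ≤ D * (∫⁻ x, f x) ^ a := by
  have H1 : ∀ f : ℝ → ℝ≥0∞, Measurable f → ∫⁻ x, f x ≠ ∞ → 
      ∫⁻ z, f (φ z) ^ a * m z ≤ D * (∫⁻ x, f x) ^ a := by
    intro f hf hfi
    obtain ⟨fj, h1, h2, h3, h4, h5⟩ := approx_aux f hf hfi
    refine fatou_aux a ha φ hφ m hm (fun j x => ENNReal.ofReal (fj j x)) f
      (fun j => (h1 j).measurable.ennreal_ofReal) hf h4 (fun j => 2 * 2⁻¹ ^ j) ?_ h5 D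
      (fun j => H (fj j) (h1 j) (h2 j) (h3 j))
    have : Tendsto (fun j : ℕ => (2:ℝ≥0∞) * 2⁻¹ ^ j) atTop (𝓝 (2 * 0)) := by
      apply ENNReal.Tendsto.const_mul
      · apply ENNReal.tendsto_pow_atTop_nhds_zero_of_lt_one
        simp
      · right; simp
    simpa using this
  refine fatou_aux a ha φ hφ m hm (fun j => (Icc (-(j:ℝ)) j).indicator fun x => min (f x) j) f
      (fun j => (hf.min measurable_const).indicator measurableSet_Icc) hf ?_ 0 tendsto_const_nhds ?_ D ?_
  · refine Eventually.of_forall fun x => ?_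
    have h1 : Tendsto (fun j : ℕ => min (f x) (j:ℝ≥0∞)) atTop (𝓝 (min (f x) ∞)) :=
      tendsto_const_nhds.min ENNReal.tendsto_nat_nhds_top
    rw [min_top_right] at h1
    refine h1.congr' ?_
    obtain ⟨N, hN⟩ := exists_nat_ge |x|
    filter_upwards [eventually_ge_atTop N] with j hj
    rw [indicator_of_mem]
    have : (N:ℝ) ≤ j := by exact_mod_cast hj
    exact abs_le.1 (hN.trans this)
  · intro j
    simp only [Pi.zero_apply, add_zero]
    apply lintegral_mono
    intro x
    refine (indicator_le_self _ _ x).trans (min_le_left _ _)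
  · intro j
    apply H1 _ ((hf.min measurable_const).indicator measurableSet_Icc)
    refine ne_top_of_le_ne_top ?_ (lintegral_mono (g := (Icc (-(j:ℝ)) j).indicator fun x => (j:ℝ≥0∞)) ?_)
    · rw [lintegral_indicator measurableSet_Icc, setLIntegral_const]
      exact ENNReal.mul_ne_top (by simp) (by simp)
    · intro x
      exact indicator_le_indicator (min_le_right _ _)

open Set Filter Topology ENNReal in
lemma young1 (r : ℝ) (hr : 1 < r) (f g k : ℝ → ℝ≥0∞)
    (hf : Measurable f) (hg : Measurable g) (hk : Measurable k) :
    ∫⁻ x, ∫⁻ y, f (x - y) ^ ((r + 1) / (2 * r)) * g (x + y) ^ ((r + 1) / (2 * r)) *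
      k y ^ ((r - 1) / r) ≤
    yC r * ((∫⁻ x, f x) ^ ((r + 1) / (2 * r)) *
      (∫⁻ x, g x) ^ ((r + 1) / (2 * r)) * (∫⁻ y, k y) ^ ((r - 1) / r)) := by
  have hr0 : 0 < r := by linarith
  set a := (r + 1) / (2 * r) with ha
  set b := (r - 1) / r with hb
  have ha0 : 0 < a := by positivity
  have q1 : Measure.QuasiMeasurePreserving (fun z : ℝ × ℝ => z.1 - z.2) :=
    quasiMeasurePreserving_sub_of_right_invariant volume volume
  have q2 : Measure.QuasiMeasurePreserving (fun z : ℝ × ℝ => z.1 + z.2) := by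
    have := (Measure.quasiMeasurePreserving_fst (μ := (volume : Measure ℝ)) (ν := (volume : Measure ℝ))).comp
      (measurePreserving_add_prod (volume : Measure ℝ) (volume : Measure ℝ)).quasiMeasurePreserving
    exact this
  -- first extend in f
  have s1 : ∀ g0 : ℝ → ℝ, Continuous g0 → (∀ x, 0 < g0 x) → Integrable g0 →
      ∫⁻ z : ℝ × ℝ, f (z.1 - z.2) ^ a * (ENNReal.ofReal (g0 (z.1 + z.2)) ^ a * k z.2 ^ b) ≤
      (yC r * ((∫⁻ x, ENNReal.ofReal (g0 x)) ^ a * (∫⁻ y, k y) ^ b)) * (∫⁻ x, f x) ^ a := by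
    intro g0 h1 h2 h3
    have := h1.measurable
    refine extend_aux a ha0 _ q1 (fun z => ENNReal.ofReal (g0 (z.1 + z.2)) ^ a * k z.2 ^ b)
      (by fun_prop) _ ?_ f hf
    intro f0 h4 h5 h6
    have := h4.measurable
    have H := young_cont r hr f0 g0 k h4 h5 h6 h1 h2 h3 hk
    rw [Measure.volume_eq_prod, lintegral_prod _ (by fun_prop)]
    simp only [mul_assoc] at H ⊢
    refine H.trans (le_of_eq ?_)
    ring
  have s2 : ∫⁻ z : ℝ × ℝ, g (z.1 + z.2) ^ a * (f (z.1 - z.2) ^ a * k z.2 ^ b) ≤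
      (yC r * ((∫⁻ x, f x) ^ a * (∫⁻ y, k y) ^ b)) * (∫⁻ x, g x) ^ a := by
    refine extend_aux a ha0 _ q2 (fun z => f (z.1 - z.2) ^ a * k z.2 ^ b) (by fun_prop) _ ?_ g hg
    intro g0 h1 h2 h3
    refine le_trans (le_of_eq ?_) ((s1 g0 h1 h2 h3).trans (le_of_eq ?_))
    · refine lintegral_congr fun z => ?_
      ring
    · ring
  rw [Measure.volume_eq_prod, lintegral_prod _ (by fun_prop)] at s2
  refine le_trans (le_of_eq ?_) (s2.trans (le_of_eq ?_))
  · refine lintegral_congr fun x => lintegral_congr fun y => ?_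
    ring
  · ring


open Set Filter Topology ENNReal in
lemma fubini_cons (n : ℕ) (F : (Fin (n + 1) → ℝ) → ℝ≥0∞) (hF : Measurable F) :
    ∫⁻ x, F x = ∫⁻ s : ℝ, ∫⁻ x : Fin n → ℝ, F (Fin.cons s x) := by
  have h := (volume_preserving_piFinSuccAbove (fun _ : Fin (n + 1) => ℝ) 0).symm
  rw [← h.lintegral_comp hF, Measure.volume_eq_prod, lintegral_prod _ (by
    exact (hF.comp (MeasurableEquiv.measurable _)).aemeasurable)]
  refine lintegral_congr fun s => lintegral_congr fun x => ?_
  congr 1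
  ext i
  refine Fin.cases ?_ (fun j => ?_) i <;> simp [MeasurableEquiv.piFinSuccAbove]

open Set Filter Topology ENNReal in
lemma measurable_cons_aux (n : ℕ) {α : Type*} [MeasurableSpace α] (s : α → ℝ) (x : α → Fin n → ℝ)
    (hs : Measurable s) (hx : Measurable x) :
    Measurable (fun z => (Fin.cons (s z) (x z) : Fin (n + 1) → ℝ)) := by
  rw [measurable_pi_iff]
  intro i
  refine Fin.cases ?_ (fun j => ?_) i
  · simpa using hs
  · simp only [Fin.cons_succ]; exact (measurable_pi_apply j).comp hx

open Set Filter Topology ENNReal in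
lemma young_n (r : ℝ) (hr : 1 < r) (n : ℕ) : ∀ (f g k : (Fin n → ℝ) → ℝ≥0∞)
    (_ : Measurable f) (_ : Measurable g) (_ : Measurable k),
    ∫⁻ x, ∫⁻ y, f (x - y) ^ ((r + 1) / (2 * r)) * g (x + y) ^ ((r + 1) / (2 * r)) *
      k y ^ ((r - 1) / r) ≤
    yC r ^ n * ((∫⁻ x, f x) ^ ((r + 1) / (2 * r)) *
      (∫⁻ x, g x) ^ ((r + 1) / (2 * r)) * (∫⁻ y, k y) ^ ((r - 1) / r)) := by
  set a := (r + 1) / (2 * r) with ha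
  set b := (r - 1) / r with hb
  induction n with
  | zero =>
    intro f g k _ _ _
    have h0 : ∀ x : Fin 0 → ℝ, x = 0 := fun x => Subsingleton.elim _ _
    have hv : (volume : Measure (Fin 0 → ℝ)) univ = 1 := by
      rw [volume_pi, Measure.pi_of_empty]; simp
    have hc : ∀ F : (Fin 0 → ℝ) → ℝ≥0∞, ∫⁻ x, F x = F 0 := by
      intro F
      have : F = fun _ => F 0 := by ext x; rw [h0 x]
      rw [this, lintegral_const, hv, mul_one]
    simp only [hc, pow_zero, one_mul, sub_zero, add_zero]
    exact le_rfl
  | succ n ih =>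
    intro f g k hf hg hk
    have m1 : Measurable (fun z : ℝ × (Fin n → ℝ) => (Fin.cons z.1 z.2 : Fin (n + 1) → ℝ)) :=
      measurable_cons_aux n _ _ measurable_fst measurable_snd
    let G : (Fin (n+1) → ℝ) → (Fin (n+1) → ℝ) → ℝ≥0∞ := fun x y =>
      f (x - y) ^ a * g (x + y) ^ a * k y ^ b
    have hG : Measurable (Function.uncurry G) := by
      simp only [G, Function.uncurry_def]; fun_prop
    have hG1 : ∀ x, Measurable (G x) := fun x => hG.comp (measurable_const.prodMk measurable_id)
    have hgen : ∀ (F : (Fin (n+1) → ℝ) → ℝ≥0∞), Measurable F →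
        Measurable (fun s : ℝ => ∫⁻ x : Fin n → ℝ, F (Fin.cons s x)) := by
      intro F hF
      exact (hF.comp m1).lintegral_prod_right'
    have e1 : ∫⁻ x, ∫⁻ y, G x y = ∫⁻ s : ℝ, ∫⁻ t : ℝ, ∫⁻ x : Fin n → ℝ, ∫⁻ y : Fin n → ℝ,
        G (Fin.cons s x) (Fin.cons t y) := by
      rw [fubini_cons n (fun x => ∫⁻ y, G x y) hG.lintegral_prod_right']
      refine lintegral_congr fun s => ?_
      simp_rw [fun x => fubini_cons n (G x) (hG1 x)]
      rw [lintegral_lintegral_swap]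
      apply Measurable.aemeasurable
      apply Measurable.lintegral_prod_right' (f := fun z : ((Fin n → ℝ) × ℝ) × (Fin n → ℝ) =>
        G (Fin.cons s z.1.1) (Fin.cons z.1.2 z.2))
      exact hG.comp ((measurable_cons_aux n _ _ (by fun_prop) (by fun_prop)).prodMk
        (measurable_cons_aux n _ _ (by fun_prop) (by fun_prop)))
    have hsub : ∀ (s t : ℝ) (x y : Fin n → ℝ), (Fin.cons s x - Fin.cons t y : Fin (n+1) → ℝ) =
        Fin.cons (s - t) (x - y) := by
      intro s t x y; ext i; refine Fin.cases ?_ (fun j => ?_) i <;> simp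
    have hadd : ∀ (s t : ℝ) (x y : Fin n → ℝ), (Fin.cons s x + Fin.cons t y : Fin (n+1) → ℝ) =
        Fin.cons (s + t) (x + y) := by
      intro s t x y; ext i; refine Fin.cases ?_ (fun j => ?_) i <;> simp
    have hsec : ∀ (F : (Fin (n+1) → ℝ) → ℝ≥0∞), Measurable F → ∀ s : ℝ,
        Measurable (fun x : Fin n → ℝ => F (Fin.cons s x)) := fun F hF s =>
      hF.comp (measurable_cons_aux n _ _ measurable_const measurable_id)
    change ∫⁻ x, ∫⁻ y, G x y ≤ _
    rw [e1]
    have e2 : ∀ s t : ℝ, ∫⁻ x : Fin n → ℝ, ∫⁻ y : Fin n → ℝ, G (Fin.cons s x) (Fin.cons t y) ≤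
        yC r ^ n * ((∫⁻ x : Fin n → ℝ, f (Fin.cons (s - t) x)) ^ a *
        (∫⁻ x : Fin n → ℝ, g (Fin.cons (s + t) x)) ^ a * (∫⁻ x : Fin n → ℝ, k (Fin.cons t x)) ^ b) := by
      intro s t
      simp only [G, hsub, hadd]
      exact ih (fun x => f (Fin.cons (s - t) x)) (fun x => g (Fin.cons (s + t) x))
        (fun x => k (Fin.cons t x)) (hsec f hf _) (hsec g hg _) (hsec k hk _)
    refine (lintegral_mono fun s => lintegral_mono fun t => e2 s t).trans ?_
    rw [fubini_cons n f hf, fubini_cons n g hg, fubini_cons n k hk]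
    have H := young1 r hr _ _ _ (hgen f hf) (hgen g hg) (hgen k hk)
    rw [← ha, ← hb] at H
    have e3 : ∀ s : ℝ, ∫⁻ t : ℝ, yC r ^ n * ((∫⁻ x : Fin n → ℝ, f (Fin.cons (s - t) x)) ^ a *
        (∫⁻ x : Fin n → ℝ, g (Fin.cons (s + t) x)) ^ a * (∫⁻ x : Fin n → ℝ, k (Fin.cons t x)) ^ b) =
        yC r ^ n * ∫⁻ t : ℝ, ((∫⁻ x : Fin n → ℝ, f (Fin.cons (s - t) x)) ^ a *
        (∫⁻ x : Fin n → ℝ, g (Fin.cons (s + t) x)) ^ a * (∫⁻ x : Fin n → ℝ, k (Fin.cons t x)) ^ b) := by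
      intro s
      rw [lintegral_const_mul]
      have a1 := (hgen f hf).comp (measurable_const_sub s)
      have a2 := (hgen g hg).comp (measurable_const_add s)
      exact ((a1.pow_const a).mul (a2.pow_const a)).mul ((hgen k hk).pow_const b)
    simp_rw [e3]
    rw [lintegral_const_mul]
    · calc _ ≤ yC r ^ n * _ := mul_le_mul_right H _
        _ = _ := by rw [pow_succ]; ring
    · apply Measurable.lintegral_prod_right' (f := fun z : ℝ × ℝ =>
        ((∫⁻ x : Fin n → ℝ, f (Fin.cons (z.1 - z.2) x)) ^ a *
        (∫⁻ x : Fin n → ℝ, g (Fin.cons (z.1 + z.2) x)) ^ a * (∫⁻ x : Fin n → ℝ, k (Fin.cons z.2 x)) ^ b))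
      have a1 := (hgen f hf).comp (measurable_fst.sub measurable_snd : Measurable fun z : ℝ × ℝ => z.1 - z.2)
      have a2 := (hgen g hg).comp (measurable_fst.add measurable_snd : Measurable fun z : ℝ × ℝ => z.1 + z.2)
      exact ((a1.pow_const a).mul (a2.pow_const a)).mul (((hgen k hk).comp measurable_snd).pow_const b)


open Set Filter Topology ENNReal Pointwise in
lemma vol_affine (lam c : ℝ) (hl : 0 < lam) (K : Set ℝ) :
    volume ((fun x => lam * x + c) '' K) = ENNReal.ofReal lam * volume K := by
  have : (fun x => lam * x + c) '' K = (fun x => x + c) '' (lam • K) := by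
    rw [← image_smul, image_image]; rfl
  rw [this, image_add_right, measure_preimage_add_right, Measure.addHaar_smul]
  simp [abs_of_pos hl]

open Set Filter Topology ENNReal in
lemma bm_compact (lam mu : ℝ) (hl : 0 < lam) (hm : 0 < mu) (K L C : Set ℝ)
    (hK : IsCompact K) (hL : IsCompact L) (hKn : K.Nonempty) (hLn : L.Nonempty)
    (hC : ∀ x ∈ K, ∀ y ∈ L, lam * x + mu * y ∈ C) :
    ENNReal.ofReal lam * volume K + ENNReal.ofReal mu * volume L ≤ volume C := by
  have ha := hK.sSup_mem hKn
  have hb := hL.sInf_mem hLn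
  set p := sSup K
  set q := sInf L
  rw [← vol_affine lam (mu * q) hl K, ← vol_affine mu (lam * p) hm L, ← measure_union₀]
  · apply measure_mono
    rintro _ (⟨x, hx, rfl⟩ | ⟨y, hy, rfl⟩)
    · exact hC x hx q hb
    · have := hC p ha y hy
      simpa [add_comm] using this
  · apply MeasurableSet.nullMeasurableSet
    exact (hL.image (by fun_prop)).measurableSet
  · apply measure_mono_null (t := {lam * p + mu * q})
    · rintro z ⟨⟨x, hx, rfl⟩, ⟨y, hy, h⟩⟩
      have h1 : x ≤ p := le_csSup hK.bddAbove hx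
      have h2 : q ≤ y := csInf_le hL.bddBelow hy
      simp only [mem_singleton_iff] at h ⊢
      nlinarith
    · simp

open Set Filter Topology ENNReal in
lemma sup_compact_aux (A : Set ℝ) (hA : MeasurableSet A) (c d M : ℝ≥0∞) (hc0 : c ≠ 0) (hct : c ≠ ∞)
    (h : ∀ K, K ⊆ A → IsCompact K → c * volume K + d ≤ M) : c * volume A + d ≤ M := by
  by_cases hd : d = ∞
  · have := h ∅ (empty_subset _) isCompact_empty
    simp [hd] at this
    simp [this]
  have : volume A ≤ (M - d) / c := by
    apply le_of_forall_lt
    intro r hr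
    obtain ⟨K, hK1, hK2, hK3⟩ := hA.exists_lt_isCompact hr
    refine hK3.trans_le ?_
    rw [ENNReal.le_div_iff_mul_le (Or.inl hc0) (Or.inl hct), mul_comm]
    exact ENNReal.le_sub_of_add_le_right hd (h K hK1 hK2)
  rw [ENNReal.le_div_iff_mul_le (Or.inl hc0) (Or.inl hct), mul_comm] at this
  have hdM : d ≤ M := by simpa using h ∅ (empty_subset _) isCompact_empty
  calc c * volume A + d ≤ (M - d) + d := by gcongr
    _ = M := tsub_add_cancel_of_le hdM

open Set Filter Topology ENNReal in
lemma bm1 (lam mu : ℝ) (hl : 0 < lam) (hm : 0 < mu) (A B C : Set ℝ)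
    (hA : MeasurableSet A) (hB : MeasurableSet B) (hAn : A.Nonempty) (hBn : B.Nonempty)
    (hC : ∀ x ∈ A, ∀ y ∈ B, lam * x + mu * y ∈ C) :
    ENNReal.ofReal lam * volume A + ENNReal.ofReal mu * volume B ≤ volume C := by
  obtain ⟨a, ha⟩ := hAn
  obtain ⟨b, hb⟩ := hBn
  apply sup_compact_aux A hA _ _ _ (by simpa using hl) (by simp)
  intro K hK1 hK2
  rw [add_comm]
  apply sup_compact_aux B hB _ _ _ (by simpa using hm) (by simp)
  intro L hL1 hL2
  have := bm_compact lam mu hl hm (insert a K) (insert b L) C (hK2.insert a) (hL2.insert b)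
    (insert_nonempty _ _) (insert_nonempty _ _)
    (fun x hx y hy => hC x (insert_subset ha hK1 hx) y (insert_subset hb hL1 hy))
  refine le_trans ?_ this
  rw [add_comm]
  gcongr <;> exact subset_insert _ _

open Set Filter Topology ENNReal in
lemma pl1_norm (lam mu : ℝ) (hl : 0 < lam) (hm : 0 < mu) (f g h : ℝ → ℝ≥0∞)
    (hs : lam + mu = 1)
    (hf : Measurable f) (hg : Measurable g) (hh : Measurable h)
    (hf1 : ∀ x, f x ≤ 1) (hg1 : ∀ x, g x ≤ 1) (hfs : ∀ t < 1, ∃ x, t < f x) (hgs : ∀ t < 1, ∃ x, t < g x)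
    (H : ∀ x y, f x ^ lam * g y ^ mu ≤ h (lam * x + mu * y)) :
    ENNReal.ofReal lam * (∫⁻ x, f x) + ENNReal.ofReal mu * (∫⁻ x, g x) ≤ ∫⁻ x, h x := by
  have lc : ∀ F : ℝ → ℝ≥0∞, Measurable F → (∀ x, F x ≤ 1) →
      ∫⁻ x, F x = ∫⁻ t in Ioi (0:ℝ), volume {x | ENNReal.ofReal t < F x} := by
    intro F hF hF1
    have hne : ∀ x, F x ≠ ∞ := fun x => ne_top_of_le_ne_top one_ne_top (hF1 x)
    have := lintegral_eq_lintegral_meas_lt volume (f := fun x => (F x).toReal)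
      (Eventually.of_forall fun x => ENNReal.toReal_nonneg) hF.ennreal_toReal.aemeasurable
    simp only [ENNReal.ofReal_toReal (hne _)] at this
    rw [this]
    refine setLIntegral_congr_fun measurableSet_Ioi fun t ht => ?_
    congr 1; ext x
    simp only [mem_ofPred_eq]
    rw [ENNReal.ofReal_lt_iff_lt_toReal (le_of_lt ht) (hne x)]
  have mono : ∀ F : ℝ → ℝ≥0∞, Measurable (fun t : ℝ => volume {x | ENNReal.ofReal t < F x}) := by
    intro F
    apply Antitone.measurable
    intro s t hst
    apply measure_mono
    intro x hx
    exact lt_of_le_of_lt (ENNReal.ofReal_le_ofReal hst) hx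
  calc _ ≤ ∫⁻ x, min (h x) 1 := by
        rw [lc f hf hf1, lc g hg hg1, lc _ (hh.min measurable_const) (fun x => min_le_right _ _),
          ← lintegral_const_mul _ (mono f), ← lintegral_const_mul _ (mono g),
          ← lintegral_add_left ((mono f).const_mul _)]
        refine setLIntegral_mono' measurableSet_Ioi fun t ht => ?_
        by_cases ht1 : t < 1
        · apply bm1 lam mu hl hm _ _ _ (measurableSet_lt measurable_const hf)
            (measurableSet_lt measurable_const hg)
          · exact hfs _ (by simpa using ht1)
          · exact hgs _ (by simpa using ht1)
          · intro x hx y hy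
            simp only [mem_ofPred_eq, lt_min_iff] at hx hy ⊢
            refine ⟨lt_of_lt_of_le ?_ (H x y), by simpa using ht1⟩
            have : ENNReal.ofReal t = ENNReal.ofReal t ^ lam * ENNReal.ofReal t ^ mu := by
              rw [← ENNReal.rpow_add _ _ (by simpa using ht) ofReal_ne_top, hs, ENNReal.rpow_one]
            rw [this]
            exact ENNReal.mul_lt_mul (ENNReal.rpow_lt_rpow hx hl) (ENNReal.rpow_lt_rpow hy hm)
        · have e : ∀ F : ℝ → ℝ≥0∞, (∀ x, F x ≤ 1) → {x | ENNReal.ofReal t < F x} = ∅ := by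
            intro F hF
            ext x
            simp only [mem_ofPred_eq, mem_empty_iff_false, iff_false, not_lt]
            refine (hF x).trans ?_
            simpa using ht1
          rw [e f hf1, e g hg1]
          simp
    _ ≤ _ := lintegral_mono fun x => min_le_left _ _

open Set Filter Topology ENNReal in
lemma amgm_aux (lam mu : ℝ) (hl : 0 < lam) (hm : 0 < mu) (hs : lam + mu = 1) (a b : ℝ≥0∞) :
    a ^ lam * b ^ mu ≤ ENNReal.ofReal lam * a + ENNReal.ofReal mu * b := by
  have hpq : (lam⁻¹).HolderConjugate (mu⁻¹) := by
    rw [Real.holderConjugate_iff]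
    refine ⟨(one_lt_inv₀ hl).2 (by linarith), by simpa using hs⟩
  have := ENNReal.young_inequality (a ^ lam) (b ^ mu) hpq
  rw [← ENNReal.rpow_mul, ← ENNReal.rpow_mul, mul_inv_cancel₀ hl.ne', mul_inv_cancel₀ hm.ne',
    ENNReal.rpow_one, ENNReal.rpow_one, ENNReal.ofReal_inv_of_pos hl, ENNReal.ofReal_inv_of_pos hm,
    ENNReal.div_eq_inv_mul, ENNReal.div_eq_inv_mul, inv_inv, inv_inv] at this
  exact this

open Set Filter Topology ENNReal in
lemma pl1_bdd (lam mu : ℝ) (hl : 0 < lam) (hm : 0 < mu) (f g h : ℝ → ℝ≥0∞)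
    (hs : lam + mu = 1)
    (hf : Measurable f) (hg : Measurable g) (hh : Measurable h) (N : ℝ≥0∞) (hN : N ≠ ∞)
    (hf1 : ∀ x, f x ≤ N) (hg1 : ∀ x, g x ≤ N)
    (H : ∀ x y, f x ^ lam * g y ^ mu ≤ h (lam * x + mu * y)) :
    (∫⁻ x, f x) ^ lam * (∫⁻ x, g x) ^ mu ≤ ∫⁻ x, h x := by
  set A := ⨆ x, f x with hA
  set B := ⨆ x, g x with hB
  have hAt : A ≠ ∞ := ne_top_of_le_ne_top hN (iSup_le hf1)
  have hBt : B ≠ ∞ := ne_top_of_le_ne_top hN (iSup_le hg1)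
  by_cases hA0 : A = 0
  · have : ∀ x, f x = 0 := by simpa using hA.symm.trans hA0
    simp [this, hl]
  by_cases hB0 : B = 0
  · have : ∀ x, g x = 0 := by simpa using hB.symm.trans hB0
    simp [this, hm]
  have hsup : ∀ (F : ℝ → ℝ≥0∞), (⨆ x, F x) ≠ 0 → (⨆ x, F x) ≠ ∞ → ∀ t < 1, ∃ x, t < (⨆ x, F x)⁻¹ * F x := by
    intro F h0 ht t ht1
    have : t * (⨆ x, F x) < ⨆ x, F x := by
      calc t * (⨆ x, F x) < 1 * (⨆ x, F x) := by
            rw [mul_comm, mul_comm 1]; exact (ENNReal.mul_lt_mul_iff_right h0 ht).2 ht1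
        _ = _ := one_mul _
    obtain ⟨x, hx⟩ := lt_iSup_iff.1 this
    refine ⟨x, ?_⟩
    rw [← ENNReal.div_eq_inv_mul]
    exact (ENNReal.lt_div_iff_mul_lt (Or.inl h0) (Or.inl ht)).2 hx
  have hle : ∀ (F : ℝ → ℝ≥0∞), (⨆ x, F x) ≠ 0 → (⨆ x, F x) ≠ ∞ → ∀ x, (⨆ x, F x)⁻¹ * F x ≤ 1 := by
    intro F h0 ht x
    rw [← ENNReal.div_eq_inv_mul]
    exact ENNReal.div_le_of_le_mul (by rw [one_mul]; exact le_iSup F x)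
  have key := pl1_norm lam mu hl hm (fun x => A⁻¹ * f x) (fun x => B⁻¹ * g x)
    (fun x => (A⁻¹ ^ lam * B⁻¹ ^ mu) * h x) hs (hf.const_mul _) (hg.const_mul _) (hh.const_mul _)
    (hle f hA0 hAt) (hle g hB0 hBt) (hsup f hA0 hAt) (hsup g hB0 hBt) (by
      intro x y
      rw [ENNReal.mul_rpow_of_nonneg _ _ hl.le, ENNReal.mul_rpow_of_nonneg _ _ hm.le]
      calc _ = (A⁻¹ ^ lam * B⁻¹ ^ mu) * (f x ^ lam * g y ^ mu) := by ring
        _ ≤ _ := by gcongr; exact H x y)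
  have key2 := (amgm_aux lam mu hl hm hs _ _).trans key
  rw [lintegral_const_mul _ hf, lintegral_const_mul _ hg, lintegral_const_mul _ hh,
    ENNReal.mul_rpow_of_nonneg _ _ hl.le, ENNReal.mul_rpow_of_nonneg _ _ hm.le] at key2
  have c0 : A⁻¹ ^ lam * B⁻¹ ^ mu ≠ 0 := by
    apply mul_ne_zero
    · simp [ENNReal.rpow_eq_zero_iff, hAt, hl.not_gt]
    · simp [ENNReal.rpow_eq_zero_iff, hBt, hm.not_gt]
  have ct : A⁻¹ ^ lam * B⁻¹ ^ mu ≠ ∞ := by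
    apply ENNReal.mul_ne_top
    · exact ENNReal.rpow_ne_top_of_nonneg hl.le (by simpa using hA0)
    · exact ENNReal.rpow_ne_top_of_nonneg hm.le (by simpa using hB0)
  rw [← ENNReal.mul_le_mul_iff_right c0 ct]
  refine le_trans (le_of_eq ?_) key2
  ring

open Set Filter Topology ENNReal in
lemma pl1 (lam mu : ℝ) (hl : 0 < lam) (hm : 0 < mu) (f g h : ℝ → ℝ≥0∞)
    (hs : lam + mu = 1)
    (hf : Measurable f) (hg : Measurable g) (hh : Measurable h)
    (H : ∀ x y, f x ^ lam * g y ^ mu ≤ h (lam * x + mu * y)) :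
    (∫⁻ x, f x) ^ lam * (∫⁻ x, g x) ^ mu ≤ ∫⁻ x, h x := by
  have hb : ∀ N : ℕ, (∫⁻ x, min (f x) N) ^ lam * (∫⁻ x, min (g x) N) ^ mu ≤ ∫⁻ x, h x := by
    intro N
    apply pl1_bdd lam mu hl hm _ _ h hs (hf.min measurable_const) (hg.min measurable_const) hh N (by simp)
      (fun x => min_le_right _ _) (fun x => min_le_right _ _)
    intro x y
    refine le_trans ?_ (H x y)
    gcongr <;> exact min_le_left _ _
  have lim : ∀ F : ℝ → ℝ≥0∞, Measurable F → ∀ a > 0, Tendsto (fun N : ℕ => (∫⁻ x, min (F x) N) ^ (a:ℝ)) atTop (𝓝 ((∫⁻ x, F x) ^ a)) := by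
    intro F hF a ha
    refine (ENNReal.continuous_rpow_const.tendsto _).comp ?_
    apply lintegral_tendsto_of_tendsto_of_monotone
    · intro N; exact (hF.min measurable_const).aemeasurable
    · refine Eventually.of_forall fun x m n hmn => ?_
      simp only
      gcongr
    · refine Eventually.of_forall fun x => ?_
      have h1 : Tendsto (fun j : ℕ => min (F x) (j:ℝ≥0∞)) atTop (𝓝 (min (F x) ∞)) :=
        tendsto_const_nhds.min ENNReal.tendsto_nat_nhds_top
      rwa [min_top_right] at h1
  by_cases h1 : ∫⁻ x, f x = 0
  · simp [h1, hl]
  by_cases h2 : ∫⁻ x, g x = 0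
  · simp [h2, hm]
  refine le_of_tendsto (ENNReal.Tendsto.mul (lim f hf lam hl) (Or.inl ?_) (lim g hg mu hm) (Or.inl ?_))
    (Eventually.of_forall hb)
  · simp [ENNReal.rpow_eq_zero_iff, h1, hl.not_gt]
  · simp [ENNReal.rpow_eq_zero_iff, h2, hm.not_gt]

open Set Filter Topology ENNReal in
lemma pl_n (lam mu : ℝ) (hl : 0 < lam) (hm : 0 < mu) (hs : lam + mu = 1) (n : ℕ) :
    ∀ (f g h : (Fin n → ℝ) → ℝ≥0∞)
    (_ : Measurable f) (_ : Measurable g) (_ : Measurable h)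
    (_ : ∀ x y, f x ^ lam * g y ^ mu ≤ h (lam • x + mu • y)),
    (∫⁻ x, f x) ^ lam * (∫⁻ x, g x) ^ mu ≤ ∫⁻ x, h x := by
  induction n with
  | zero =>
    intro f g h _ _ _ H
    have h0 : ∀ x : Fin 0 → ℝ, x = 0 := fun x => Subsingleton.elim _ _
    have hv : (volume : Measure (Fin 0 → ℝ)) univ = 1 := by
      rw [volume_pi, Measure.pi_of_empty]; simp
    have hc : ∀ F : (Fin 0 → ℝ) → ℝ≥0∞, ∫⁻ x, F x = F 0 := by
      intro F
      have : F = fun _ => F 0 := by ext x; rw [h0 x]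
      rw [this, lintegral_const, hv, mul_one]
    have := H 0 0
    rw [h0 (lam • 0 + mu • 0)] at this
    simpa only [hc] using this
  | succ n ih =>
    intro f g h hf hg hh H
    have m1 : Measurable (fun z : ℝ × (Fin n → ℝ) => (Fin.cons z.1 z.2 : Fin (n + 1) → ℝ)) :=
      measurable_cons_aux n _ _ measurable_fst measurable_snd
    have hgen : ∀ (F : (Fin (n+1) → ℝ) → ℝ≥0∞), Measurable F →
        Measurable (fun s : ℝ => ∫⁻ x : Fin n → ℝ, F (Fin.cons s x)) := by
      intro F hF
      exact (hF.comp m1).lintegral_prod_right'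
    have hsec : ∀ (F : (Fin (n+1) → ℝ) → ℝ≥0∞), Measurable F → ∀ s : ℝ,
        Measurable (fun x : Fin n → ℝ => F (Fin.cons s x)) := fun F hF s =>
      hF.comp (measurable_cons_aux n _ _ measurable_const measurable_id)
    rw [fubini_cons n f hf, fubini_cons n g hg, fubini_cons n h hh]
    apply pl1 lam mu hl hm _ _ _ hs (hgen f hf) (hgen g hg) (hgen h hh)
    intro s t
    apply ih _ _ _ (hsec f hf s) (hsec g hg t) (hsec h hh _)
    intro x y
    refine (H _ _).trans (le_of_eq ?_)
    congr 1
    ext i; refine Fin.cases ?_ (fun j => ?_) i <;> simp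


open Set Filter Topology ENNReal in
lemma deriv_le_aux (F G : ℝ → ℝ) (F' G' a : ℝ) (hF : HasDerivWithinAt F F' (Ioi a) a)
    (hG : HasDerivWithinAt G G' (Ioi a) a) (h0 : F a = G a) (h : ∀ᶠ x in 𝓝[>] a, F x ≤ G x) :
    F' ≤ G' := by
  rw [hasDerivWithinAt_iff_tendsto_slope' (by simp)] at hF hG
  refine le_of_tendsto_of_tendsto hF hG ?_
  filter_upwards [h, self_mem_nhdsWithin] with x hx hxa
  have : 0 < x - a := sub_pos.2 hxa
  rw [slope_def_field, slope_def_field, h0]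
  gcongr

open Set Filter Topology ENNReal in
lemma ofReal_int_le {α : Type*} [MeasurableSpace α] (μ : Measure α) (f : α → ℝ) (hf : Integrable f μ) :
    ENNReal.ofReal (∫ x, f x ∂μ) ≤ ∫⁻ x, ENNReal.ofReal (f x) ∂μ := by
  rw [integral_eq_lintegral_pos_part_sub_lintegral_neg_part hf]
  refine (ENNReal.ofReal_le_ofReal (sub_le_self _ ENNReal.toReal_nonneg)).trans ?_
  exact ENNReal.ofReal_toReal_le

open Set Filter Topology ENNReal in
lemma bounded_aux (n : ℕ) (q : (Fin n → ℝ) → ℝ≥0∞) (hq : Measurable q) (h1 : ∫⁻ x, q x = 1)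
    (hlc : ∀ x y : Fin n → ℝ, ∀ t : ℝ, 0 < t → t < 1 →
      q x ^ t * q y ^ (1 - t) ≤ q (t • x + (1 - t) • y)) :
    ∃ M : ℝ≥0∞, M ≠ ∞ ∧ ∀ x, q x ≤ M := by
  set S := ∫⁻ x, q x ^ (1/2 : ℝ) with hS
  have hS0 : S ≠ 0 := by
    intro h
    rw [hS, lintegral_eq_zero_iff (hq.pow_const _)] at h
    have : ∫⁻ x, q x = 0 := by
      rw [lintegral_eq_zero_iff hq]
      filter_upwards [h] with x hx
      have hx' : q x ^ (1/2 : ℝ) = 0 := hx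
      exact (ENNReal.rpow_eq_zero_iff_of_pos (by norm_num)).1 hx'
    rw [this] at h1
    exact zero_ne_one h1
  have key : ∀ z, q z ^ (1/2:ℝ) * S ≤ 2 ^ n := by
    intro z
    have e : ∫⁻ x, q ((1/2:ℝ) • x + (1 - 1/2 : ℝ) • z) = 2 ^ n := by
      rw [lintegral_comp_smul_aux volume (fun x => q (x + (1 - 1/2 : ℝ) • z)) (1/2) (by norm_num),
        lintegral_add_right_eq_self q, h1, mul_one, Module.finrank_fin_fun, one_div,
        ENNReal.ofReal_inv_of_pos (by norm_num), ← ENNReal.inv_pow, inv_inv]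
      simp
    rw [← e, hS, ← lintegral_const_mul _ (hq.pow_const _)]
    refine lintegral_mono fun x => ?_
    have := hlc x z (1/2) (by norm_num) (by norm_num)
    rw [mul_comm]
    refine le_trans (le_of_eq ?_) this
    norm_num
  refine ⟨(2 ^ n / S) ^ (2:ℝ), ?_, fun z => ?_⟩
  · exact ENNReal.rpow_ne_top_of_nonneg (by norm_num) (ENNReal.div_ne_top (by simp) hS0)
  · have := (ENNReal.le_div_iff_mul_le (Or.inl hS0) (Or.inr (by simp))).2 (key z)
    calc q z = (q z ^ (1/2:ℝ)) ^ (2:ℝ) := by rw [← ENNReal.rpow_mul]; norm_num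
      _ ≤ _ := by gcongr

open Set Filter Topology ENNReal in
lemma regularize (n : ℕ) (p : (Fin n → ℝ) → ℝ) (hnn : ∀ x, 0 ≤ p x)
    (hlc : ∀ x y : Fin n → ℝ, ∀ t : ℝ, 0 ≤ t → t ≤ 1 →
      p x ^ t * p y ^ (1 - t) ≤ p (t • x + (1 - t) • y)) :
    ∃ q : (Fin n → ℝ) → ℝ, Measurable q ∧ (∀ x, 0 ≤ q x) ∧ q =ᵐ[volume] p ∧
      ∀ x y : Fin n → ℝ, ∀ t : ℝ, 0 < t → t < 1 →
      q x ^ t * q y ^ (1 - t) ≤ q (t • x + (1 - t) • y) := by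
  set S := {x | 0 < p x} with hS
  have hconv : Convex ℝ S := by
    intro x hx y hy a b ha hb hab
    have : b = 1 - a := by linarith
    subst this
    refine lt_of_lt_of_le ?_ (hlc x y a ha (by linarith))
    have hx' : 0 < p x := hx
    have hy' : 0 < p y := hy
    positivity
  have hconc : ConcaveOn ℝ S (fun x => Real.log (p x)) := by
    refine ⟨hconv, ?_⟩
    intro x hx y hy a b ha hb hab
    have : b = 1 - a := by linarith
    subst this
    have hx' : 0 < p x := hx
    have hy' : 0 < p y := hy
    have := Real.log_le_log (by positivity) (hlc x y a ha (by linarith))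
    rw [Real.log_mul (by positivity) (by positivity), Real.log_rpow hx', Real.log_rpow hy'] at this
    simpa using this
  have hcont := hconc.continuousOn_interior
  have hpos : ∀ x ∈ interior S, 0 < p x := fun x hx =>
    (interior_subset hx : x ∈ S)
  have hcp : ContinuousOn p (interior S) :=
    (Real.continuous_exp.comp_continuousOn hcont).congr fun x hx => by
      simp [Real.exp_log (hpos x hx)]
  classical
  refine ⟨(interior S).indicator p, ?_, ?_, ?_, ?_⟩
  · rw [← Set.piecewise_eq_indicator]
    exact hcp.measurable_piecewise continuousOn_const isOpen_interior.measurableSet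
  · intro x
    exact Set.indicator_nonneg (fun x _ => hnn x) x
  · have h0 : volume (frontier S) = 0 := hconv.addHaar_frontier volume
    have h0' : ∀ᵐ x, x ∉ frontier S := measure_eq_zero_iff_ae_notMem.1 h0
    filter_upwards [h0'] with x hx
    by_cases hi : x ∈ interior S
    · simp [hi]
    · rw [Set.indicator_of_notMem hi]
      by_contra hne
      apply hx
      refine ⟨subset_closure ?_, hi⟩
      exact lt_of_le_of_ne (hnn x) hne
  · intro x y t ht0 ht1
    by_cases hx : x ∈ interior S
    · by_cases hy : y ∈ interior S
      · have := hconv.interior hx hy ht0.le (by linarith : 0 ≤ 1 - t) (by ring)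
        rw [Set.indicator_of_mem hx, Set.indicator_of_mem hy, Set.indicator_of_mem this]
        exact hlc x y t ht0.le ht1.le
      · rw [Set.indicator_of_notMem hy, Real.zero_rpow (by linarith), mul_zero]
        exact Set.indicator_nonneg (fun x _ => hnn x) _
    · rw [Set.indicator_of_notMem hx, Real.zero_rpow (by linarith), zero_mul]
      exact Set.indicator_nonneg (fun x _ => hnn x) _

open Set Filter Topology ENNReal in
lemma conv_facts (n : ℕ) (q : (Fin n → ℝ) → ℝ≥0∞) (hq : Measurable q) (h1 : ∫⁻ x, q x = 1) (M : ℝ≥0∞)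
    (hM : ∀ x, q x ≤ M) :
    Measurable (fun x => ∫⁻ y, q (x + y) * q y) ∧ (∀ x, ∫⁻ y, q (x + y) * q y ≤ M) ∧
    ∫⁻ x, ∫⁻ y, q (x + y) * q y = 1 := by
  refine ⟨?_, ?_, ?_⟩
  · apply Measurable.lintegral_prod_right' (f := fun z : (Fin n → ℝ) × (Fin n → ℝ) => q (z.1 + z.2) * q z.2)
    fun_prop
  · intro x
    calc _ ≤ ∫⁻ y, M * q y := lintegral_mono fun y => by gcongr; exact hM _
      _ = M := by rw [lintegral_const_mul _ hq, h1, mul_one]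
  · rw [lintegral_lintegral_swap (by apply Measurable.aemeasurable; simp only [Function.uncurry_def]; fun_prop)]
    calc _ = ∫⁻ y, 1 * q y := by
          refine lintegral_congr fun y => ?_
          rw [lintegral_mul_const _ (by fun_prop), lintegral_add_right_eq_self q, h1]
      _ = 1 := by simp [h1]

open Set Filter Topology ENNReal in
lemma upper_conv (n : ℕ) (q : (Fin n → ℝ) → ℝ≥0∞) (hq : Measurable q) (h1 : ∫⁻ x, q x = 1) (M : ℝ≥0∞)
    (hM : ∀ x, q x ≤ M)
    (hlc : ∀ x y : Fin n → ℝ, ∀ t : ℝ, 0 < t → t < 1 →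
      q x ^ t * q y ^ (1 - t) ≤ q (t • x + (1 - t) • y)) (D : (Fin n → ℝ) → ℝ≥0∞)
    (hD : D = fun x => ∫⁻ y, q (x + y) * q y) (t : ℝ) (ht0 : 0 < t) (ht1 : t < 1) :
    (∫⁻ x, D x ^ t) * D 0 ^ (1 - t) ≤ (ENNReal.ofReal t ^ n)⁻¹ := by
  obtain ⟨f1, f2, f3⟩ := conv_facts n q hq h1 M hM
  rw [← hD] at f1
  have key : ∀ x, D x ^ t * D 0 ^ (1 - t) ≤ D (t • x) := by
    intro x
    rw [hD]
    simp only
    apply pl_n t (1 - t) ht0 (by linarith) (by ring) n (fun y => q (x + y) * q y) (fun y => q (0 + y) * q y)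
      (fun y => q (t • x + y) * q y) (by fun_prop) (by fun_prop) (by fun_prop)
    intro y z
    rw [ENNReal.mul_rpow_of_nonneg _ _ ht0.le, ENNReal.mul_rpow_of_nonneg _ _ (by linarith : 0 ≤ 1 - t)]
    have a1 := hlc (x + y) (0 + z) t ht0 ht1
    have a2 := hlc y z t ht0 ht1
    calc _ = (q (x + y) ^ t * q (0 + z) ^ (1 - t)) * (q y ^ t * q z ^ (1 - t)) := by ring
      _ ≤ _ := mul_le_mul' a1 a2
      _ = _ := by
        congr 2
        rw [zero_add, smul_add, add_assoc]
  rw [← lintegral_mul_const _ (f1.pow_const t)]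
  refine (lintegral_mono key).trans ?_
  rw [lintegral_comp_smul_aux volume D t ht0, Module.finrank_fin_fun, hD, f3, mul_one]

open Set Filter Topology ENNReal in
lemma lower_conv (n : ℕ) (q : (Fin n → ℝ) → ℝ≥0∞) (hq : Measurable q) (h1 : ∫⁻ x, q x = 1) (M : ℝ≥0∞)
    (hMt : M ≠ ∞) (hM : ∀ x, q x ≤ M) (D : (Fin n → ℝ) → ℝ≥0∞)
    (hD : D = fun x => ∫⁻ y, q (x + y) * q y) (r : ℝ) (hr : 1 < r) :
    ∫⁻ x, D x ^ r ≤ 2 ^ n * (yC r ^ r) ^ n * (∫⁻ x, q x ^ (2 * r / (r + 1))) ^ (r + 1) := by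
  obtain ⟨f1, f2, f3⟩ := conv_facts n q hq h1 M hM
  have f2' : ∀ x, D x ≤ M := by rw [hD]; exact f2
  have f3' : ∫⁻ x, D x = 1 := by rw [hD]; exact f3
  rw [← hD] at f1
  set J := ∫⁻ x, D x ^ r with hJ
  set I := ∫⁻ x, q x ^ (2 * r / (r + 1)) with hI
  have hJt : J ≠ ∞ := by
    have : J ≤ M ^ (r - 1) * 1 := by
      rw [← f3', ← lintegral_const_mul _ f1]
      refine lintegral_mono fun x => ?_
      calc D x ^ r = D x ^ (r - 1) * D x := by
            conv_rhs => rw [← ENNReal.rpow_one (D x), ← ENNReal.rpow_mul, one_mul, ← ENNReal.rpow_add_of_nonneg _ _ (by linarith) zero_le_one]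
            congr 1; ring
        _ ≤ _ := by gcongr; exact f2' x
    refine ne_top_of_le_ne_top ?_ this
    rw [mul_one]
    exact ENNReal.rpow_ne_top_of_nonneg (by linarith) hMt
  have hJ0 : J ≠ 0 := by
    intro h
    rw [hJ, lintegral_eq_zero_iff (f1.pow_const _)] at h
    have : ∫⁻ x, D x = 0 := by
      rw [lintegral_eq_zero_iff f1]
      filter_upwards [h] with x hx
      simp [ENNReal.rpow_eq_zero_iff] at hx
      rcases hx with hx | hx
      · exact hx.1
      · linarith
    rw [this] at f3'
    exact zero_ne_one f3'
  set s := 2 * r / (r + 1) with hs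
  have hsa : s * ((r + 1) / (2 * r)) = 1 := by rw [hs]; field_simp
  have H := young_n r hr n (fun x => q x ^ s) (fun x => q x ^ s) (fun y => D ((2:ℝ) • y) ^ r)
    (hq.pow_const _) (hq.pow_const _) ((f1.comp (measurable_const_smul _)).pow_const _)
  simp only [← ENNReal.rpow_mul, hsa, ENNReal.rpow_one] at H
  have hrb : r * ((r - 1) / r) = r - 1 := by field_simp
  rw [hrb] at H
  have e1 : ∫⁻ y : Fin n → ℝ, D ((2:ℝ) • y) ^ r = (2 ^ n)⁻¹ * J := by
    rw [lintegral_comp_smul_aux volume (fun x => D x ^ r) 2 (by norm_num), Module.finrank_fin_fun]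
    simp [hJ]
  have e2 : ∫⁻ x, ∫⁻ y, q (x - y) * q (x + y) * D ((2:ℝ) • y) ^ (r - 1) = (2 ^ n)⁻¹ * J := by
    rw [lintegral_lintegral_swap (by
      apply Measurable.aemeasurable
      have : Measurable (fun z : (Fin n → ℝ) × (Fin n → ℝ) => D ((2:ℝ) • z.2) ^ (r - 1)) :=
        (f1.comp (measurable_snd.const_smul (2:ℝ))).pow_const _
      simp only [Function.uncurry_def]
      exact Measurable.mul (by fun_prop) this), ← e1]
    refine lintegral_congr fun y => ?_
    rw [lintegral_mul_const _ (by fun_prop)]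
    have : ∫⁻ x, q (x - y) * q (x + y) = D ((2:ℝ) • y) := by
      rw [← lintegral_add_right_eq_self (fun x => q (x - y) * q (x + y)) y, hD]
      refine lintegral_congr fun x => ?_
      rw [mul_comm]
      congr 2
      · rw [two_smul]; abel
      · abel
    rw [this]
    conv_lhs => rw [← ENNReal.rpow_one (D ((2:ℝ) • y)), ← ENNReal.rpow_mul, one_mul, ← ENNReal.rpow_add_of_nonneg _ _ zero_le_one (by linarith)]
    congr 1; ring
  rw [e2, e1] at H
  set T := (2 ^ n)⁻¹ * J with hT
  have hT0 : T ≠ 0 := mul_ne_zero (by simp) hJ0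
  have hTt : T ≠ ∞ := ENNReal.mul_ne_top (by simp) hJt
  have H2 : T ^ (1/r) ≤ yC r ^ n * I ^ ((r + 1)/r) := by
    have c0 : T ^ ((r-1)/r) ≠ 0 := by simp [ENNReal.rpow_eq_zero_iff, hT0, hTt]
    have ct : T ^ ((r-1)/r) ≠ ∞ := by simp [ENNReal.rpow_eq_top_iff, hT0, hTt]
    rw [← ENNReal.mul_le_mul_iff_left c0 ct, ← ENNReal.rpow_add _ _ hT0 hTt]
    have : 1 / r + (r - 1) / r = 1 := by field_simp; ring
    rw [this, ENNReal.rpow_one]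
    refine H.trans (le_of_eq ?_)
    rw [← ENNReal.rpow_add_of_nonneg _ _ (by positivity) (by positivity)]
    have : (r + 1) / (2 * r) + (r + 1) / (2 * r) = (r + 1) / r := by field_simp; ring
    rw [this]; ring
  have H3 := ENNReal.rpow_le_rpow H2 (by linarith : 0 ≤ r)
  rw [← ENNReal.rpow_mul, ENNReal.mul_rpow_of_nonneg _ _ (by linarith : 0 ≤ r), ← ENNReal.rpow_mul] at H3
  have a1 : 1 / r * r = 1 := by field_simp
  have a2 : (r + 1) / r * r = r + 1 := by field_simp
  rw [a1, a2, ENNReal.rpow_one] at H3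
  have hJT : J = 2 ^ n * T := by
    rw [hT, ← mul_assoc, ENNReal.mul_inv_cancel (by simp) (by simp), one_mul]
  rw [hJT, mul_assoc]
  refine mul_le_mul_right (H3.trans (le_of_eq ?_)) _
  congr 1
  rw [← ENNReal.rpow_natCast, ← ENNReal.rpow_natCast, ← ENNReal.rpow_mul, ← ENNReal.rpow_mul, mul_comm]

open Set Filter Topology ENNReal in
lemma yC_val (r : ℝ) (hr : 1 < r) :
    yC r ^ r = ENNReal.ofReal (√(r / (r + 1)) ^ r * √(1 / (r + 1))) := by
  have g : ∀ b : ℝ, 0 < b → ∫⁻ x : ℝ, ENNReal.ofReal (Real.exp (-b * x ^ 2)) = ENNReal.ofReal (√(π / b)) := by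
    intro b hb
    rw [← integral_gaussian b, ofReal_integral_eq_lintegral_ofReal (integrable_exp_neg_mul_sq hb)]
    exact Eventually.of_forall fun x => (Real.exp_pos _).le
  have hr0 : 0 < r := by linarith
  unfold yC
  rw [g _ (by positivity), g _ (by positivity), ENNReal.mul_rpow_of_nonneg _ _ hr0.le,
    ← ENNReal.rpow_mul, one_div_mul_cancel hr0.ne', ENNReal.rpow_one,
    ENNReal.ofReal_rpow_of_nonneg (by positivity) hr0.le, ← ENNReal.ofReal_mul (by positivity)]
  have e1 : π / (2 * π * ((r + 1) / (2 * r))) = r / (r + 1) := by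
    have := Real.pi_pos; field_simp
  have e2 : π / (π * (r + 1)) = 1 / (r + 1) := by
    have := Real.pi_pos; field_simp
  rw [e1, e2]


open Set Filter Topology ENNReal in
lemma rpow_lower (x s : ℝ) (hx : 0 ≤ x) (hs : 0 < s) :
    x + (s - 1) * (x * Real.log x) ≤ x ^ s := by
  rcases hx.eq_or_lt with rfl | hx
  · simp [Real.zero_rpow hs.ne']
  · have : x ^ s = x * Real.exp ((s - 1) * Real.log x) := by
      rw [Real.rpow_def_of_pos hx]
      conv_rhs => rw [← Real.exp_log hx, ← Real.exp_add, Real.exp_log hx]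
      congr 1; ring
    rw [this]
    nlinarith [Real.add_one_le_exp ((s - 1) * Real.log x)]

open Set Filter Topology ENNReal in
lemma rpow_upper (x s : ℝ) (hx : 0 ≤ x) (hs : 1 ≤ s) (hs2 : s ≤ 2) :
    x ^ s ≤ x + (s - 1) * (x ^ 2 - x) := by
  rcases hx.eq_or_lt with rfl | hx
  · simp [Real.zero_rpow (by linarith : s ≠ 0)]
  have := Real.geom_mean_le_arith_mean2_weighted (by linarith : 0 ≤ 2 - s) (by linarith : 0 ≤ s - 1)
    hx.le (by positivity : 0 ≤ x ^ 2) (by ring)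
  have e : x ^ (2 - s) * (x ^ 2) ^ (s - 1) = x ^ s := by
    rw [← Real.rpow_natCast x 2, ← Real.rpow_mul hx.le, ← Real.rpow_add hx]
    congr 1; push_cast; ring
  rw [e] at this
  linarith

open Set Filter Topology ENNReal in
lemma integrable_rpow_aux {α : Type*} [MeasurableSpace α] (μ : Measure α) (p : α → ℝ) (hp : Measurable p)
    (hnn : ∀ x, 0 ≤ p x) (hi : Integrable p μ) (h2 : Integrable (fun x => p x ^ 2) μ) (s : ℝ)
    (hs : 1 ≤ s) (hs2 : s ≤ 2) : Integrable (fun x => p x ^ s) μ := by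
  refine Integrable.mono' (hi.add ((h2.sub hi).const_mul (s - 1))) (hp.pow_const s).aestronglyMeasurable ?_
  refine Eventually.of_forall fun x => ?_
  rw [Real.norm_of_nonneg (Real.rpow_nonneg (hnn x) s)]
  exact rpow_upper _ _ (hnn x) hs hs2

open Set Filter Topology ENNReal in
lemma deriv_int_aux {α : Type*} [MeasurableSpace α] (μ : Measure α) (p : α → ℝ) (hp : Measurable p)
    (hnn : ∀ x, 0 ≤ p x) (hi : Integrable p μ) (h2 : Integrable (fun x => p x ^ 2) μ)
    (hl : Integrable (fun x => p x * Real.log (p x)) μ) :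
    HasDerivWithinAt (fun s : ℝ => ∫ x, p x ^ s ∂μ) (∫ x, p x * Real.log (p x) ∂μ) (Ioi 1) 1 := by
  rw [hasDerivWithinAt_iff_tendsto_slope' (by simp)]
  have hev : ∀ᶠ s in 𝓝[>] (1:ℝ), s ∈ Ioc (1:ℝ) 2 := by
    filter_upwards [Ioc_mem_nhdsGT (by norm_num : (1:ℝ) < 2)] with s hs using hs
  have key : Tendsto (fun s : ℝ => ∫ x, (p x ^ s - p x) / (s - 1) ∂μ) (𝓝[>] 1)
      (𝓝 (∫ x, p x * Real.log (p x) ∂μ)) := by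
    apply tendsto_integral_filter_of_dominated_convergence
      (fun x => |p x * Real.log (p x)| + |p x ^ 2 - p x|)
    · filter_upwards with s
      exact (((hp.pow_const s).sub hp).div_const _).aestronglyMeasurable
    · filter_upwards [hev] with s hs
      filter_upwards with x
      have h0 : 0 < s - 1 := by linarith [hs.1]
      have a1 := rpow_lower (p x) s (hnn x) (by linarith)
      have a2 := rpow_upper (p x) s (hnn x) hs.1.le hs.2
      have b1 : p x * Real.log (p x) ≤ (p x ^ s - p x) / (s - 1) := by
        rw [le_div_iff₀ h0]; linarith
      have b2 : (p x ^ s - p x) / (s - 1) ≤ p x ^ 2 - p x := by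
        rw [div_le_iff₀ h0]; linarith
      rw [Real.norm_eq_abs, abs_le]
      constructor
      · linarith [neg_abs_le (p x * Real.log (p x)), abs_nonneg (p x ^ 2 - p x)]
      · linarith [le_abs_self (p x ^ 2 - p x), abs_nonneg (p x * Real.log (p x))]
    · exact hl.abs.add (h2.sub hi).abs
    · filter_upwards with x
      rcases (hnn x).eq_or_lt with h | h
      · rw [← h]
        simp only [zero_mul, sub_zero]
        apply tendsto_const_nhds.congr'
        filter_upwards [hev] with s hs
        rw [Real.zero_rpow (by linarith [hs.1]), zero_div]
      · have hd : HasDerivAt (fun s : ℝ => p x ^ s) (p x * Real.log (p x)) 1 := by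
          simpa using (Real.hasStrictDerivAt_const_rpow h 1).hasDerivAt
        have := (hasDerivWithinAt_iff_tendsto_slope' (by simp)).1 (hd.hasDerivWithinAt (s := Ioi 1))
        refine this.congr fun s => ?_
        rw [slope_def_field, Real.rpow_one]
  refine key.congr' ?_
  filter_upwards [hev] with s hs
  rw [slope_def_field, integral_div, integral_sub (integrable_rpow_aux μ p hp hnn hi h2 s hs.1.le hs.2) hi]
  simp

open Set Filter Topology ENNReal in
lemma core (n : ℕ) (p : (Fin n → ℝ) → ℝ) (hp : Measurable p)
    (hnn : ∀ x, 0 ≤ p x) (hpdf : ∫ x, p x = 1)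
    (hlc : ∀ x y : Fin n → ℝ, ∀ t : ℝ, 0 < t → t < 1 →
      p x ^ t * p y ^ (1 - t) ≤ p (t • x + (1 - t) • y))
    (d : (Fin n → ℝ) → ℝ)
    (hd : d = fun x => ∫ y, p (x + y) * p y)
    (h1 : Integrable fun x => p x * Real.log (p x))
    (h3 : Integrable fun x => d x * Real.log (d x)) :
    (∫ x, d x * Real.log (d x)) ≤ -(n * Real.log 2 / 2) + ∫ x, p x * Real.log (p x) ∧
    (∫ x, p x * Real.log (p x)) ≤ n + ∫ x, d x * Real.log (d x) := by
  have hpi : Integrable p := by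
    by_contra h
    rw [integral_undef h] at hpdf
    exact zero_ne_one hpdf
  set q : (Fin n → ℝ) → ℝ≥0∞ := fun x => ENNReal.ofReal (p x) with hqdef
  have hq : Measurable q := hp.ennreal_ofReal
  have hq1 : ∫⁻ x, q x = 1 := by
    rw [hqdef, ← ofReal_integral_eq_lintegral_ofReal hpi (Eventually.of_forall hnn), hpdf, ENNReal.ofReal_one]
  have hlcq : ∀ x y : Fin n → ℝ, ∀ t : ℝ, 0 < t → t < 1 →
      q x ^ t * q y ^ (1 - t) ≤ q (t • x + (1 - t) • y) := by
    intro x y t ht0 ht1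
    simp only [hqdef]
    rw [ENNReal.ofReal_rpow_of_nonneg (hnn _) ht0.le, ENNReal.ofReal_rpow_of_nonneg (hnn _) (by linarith),
      ← ENNReal.ofReal_mul (Real.rpow_nonneg (hnn _) _)]
    exact ENNReal.ofReal_le_ofReal (hlc x y t ht0 ht1)
  obtain ⟨M, hMt, hM⟩ := bounded_aux n q hq hq1 hlcq
  have hpM : ∀ x, p x ≤ M.toReal := fun x => by
    have := ENNReal.toReal_mono hMt (hM x)
    rwa [hqdef, ENNReal.toReal_ofReal (hnn x)] at this
  set D : (Fin n → ℝ) → ℝ≥0∞ := fun x => ∫⁻ y, q (x + y) * q y with hD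
  obtain ⟨f1, f2, f3⟩ := conv_facts n q hq hq1 M hM
  change Measurable D at f1
  change ∀ x, D x ≤ M at f2
  change ∫⁻ x, D x = 1 at f3
  have hDt : ∀ x, D x ≠ ∞ := fun x => ne_top_of_le_ne_top hMt (f2 x)
  have hdD : ∀ x, d x = (D x).toReal := by
    intro x
    rw [hd, hD]
    simp only
    rw [integral_eq_lintegral_of_nonneg_ae (Eventually.of_forall fun y => mul_nonneg (hnn _) (hnn _))
      (by fun_prop)]
    congr 1
    refine lintegral_congr fun y => ?_
    rw [ENNReal.ofReal_mul (hnn _)]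
  have hDd : ∀ x, D x = ENNReal.ofReal (d x) := fun x => by rw [hdD, ENNReal.ofReal_toReal (hDt x)]
  have hdnn : ∀ x, 0 ≤ d x := fun x => by rw [hdD]; exact ENNReal.toReal_nonneg
  have hdm : Measurable d := by
    have : d = fun x => (D x).toReal := funext hdD
    rw [this]; exact f1.ennreal_toReal
  have hdi : Integrable d := by
    refine ⟨hdm.aestronglyMeasurable, ?_⟩
    rw [hasFiniteIntegral_iff_ofReal (Eventually.of_forall hdnn)]
    simp_rw [← hDd]
    rw [f3]; exact one_lt_top
  have hd1 : ∫ x, d x = 1 := by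
    rw [integral_eq_lintegral_of_nonneg_ae (Eventually.of_forall hdnn) hdm.aestronglyMeasurable]
    simp_rw [← hDd]
    rw [f3]; simp
  have hp2 : Integrable (fun x => p x ^ 2) := by
    refine Integrable.mono' (hpi.const_mul M.toReal) (by fun_prop) (Eventually.of_forall fun x => ?_)
    rw [Real.norm_of_nonneg (by positivity)]
    nlinarith [hpM x, hnn x]
  set K := ∫ x, d x * Real.log (d x) with hK
  set m := ∫ x, p x * Real.log (p x) with hm
  have hlow : ∀ s : ℝ, 0 < s → ENNReal.ofReal (1 + (s - 1) * K) ≤ ∫⁻ x, D x ^ s := by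
    intro s hs
    have : 1 + (s - 1) * K = ∫ x, (d x + (s - 1) * (d x * Real.log (d x))) := by
      rw [integral_add hdi (h3.const_mul _), integral_const_mul, hd1]
    rw [this]
    refine (ofReal_int_le volume _ (hdi.add (h3.const_mul _))).trans ?_
    refine lintegral_mono fun x => ?_
    rw [hDd, ENNReal.ofReal_rpow_of_nonneg (hdnn x) hs.le]
    exact ENNReal.ofReal_le_ofReal (rpow_lower _ _ (hdnn x) hs)
  constructor
  · -- lower bound
    have hJ : ∀ r : ℝ, 1 < r → 1 + (r - 1) * K ≤
        2 ^ n * (√(r / (r + 1)) ^ r * √(1 / (r + 1))) ^ n * (∫ x, p x ^ (2 * r / (r + 1))) ^ (r + 1) := by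
      intro r hr
      have hs0 : 0 ≤ 2 * r / (r + 1) := by positivity
      have hs1 : 1 ≤ 2 * r / (r + 1) := by rw [le_div_iff₀ (by linarith)]; linarith
      have hs2 : 2 * r / (r + 1) ≤ 2 := by rw [div_le_iff₀ (by linarith)]; linarith
      have hI : ∫⁻ x, q x ^ (2 * r / (r + 1)) = ENNReal.ofReal (∫ x, p x ^ (2 * r / (r + 1))) := by
        rw [ofReal_integral_eq_lintegral_ofReal (integrable_rpow_aux volume p hp hnn hpi hp2 _ hs1 hs2)
          (Eventually.of_forall fun x => Real.rpow_nonneg (hnn x) _)]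
        refine lintegral_congr fun x => ?_
        rw [hqdef, ENNReal.ofReal_rpow_of_nonneg (hnn x) hs0]
      have hI0 : 0 ≤ ∫ x, p x ^ (2 * r / (r + 1)) := integral_nonneg fun x => Real.rpow_nonneg (hnn x) _
      have := (hlow r (by linarith)).trans (lower_conv n q hq hq1 M hMt hM D hD r hr)
      rw [yC_val r hr, hI, ENNReal.ofReal_rpow_of_nonneg hI0 (by linarith),
        ← ENNReal.ofReal_pow (by positivity)] at this
      have e2 : (2:ℝ≥0∞) ^ n = ENNReal.ofReal (2 ^ n) := by
        rw [ENNReal.ofReal_pow (by norm_num)]; simp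
      rw [e2, ← ENNReal.ofReal_mul (by positivity), ← ENNReal.ofReal_mul (by positivity)] at this
      exact (ENNReal.ofReal_le_ofReal_iff (by positivity)).1 this
    have hI1 : ∫ x, p x ^ (1:ℝ) = 1 := by simpa using hpdf
    have hIder := deriv_int_aux volume p hp hnn hpi hp2 h1
    set I : ℝ → ℝ := fun s => ∫ x, p x ^ s with hIdef
    have hI1' : I 1 = 1 := hI1
    have hsder : HasDerivWithinAt (fun r : ℝ => 2 * r / (r + 1)) (1/2) (Ioi 1) 1 := by
      have : HasDerivAt (fun r : ℝ => 2 * r / (r + 1)) (1/2) 1 := by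
        have t := (((hasDerivAt_id (1:ℝ)).const_mul 2).div ((hasDerivAt_id (1:ℝ)).add_const 1) (by norm_num))
        exact t.congr_deriv (by norm_num)
      exact this.hasDerivWithinAt
    have hIs : HasDerivWithinAt (fun r : ℝ => I (2 * r / (r + 1))) (m * (1/2)) (Ioi 1) 1 := by
      have h11 : (2 * (1:ℝ) / (1 + 1)) = 1 := by norm_num
      refine HasDerivWithinAt.comp (h₂ := I) (s' := Ioi 1) (1:ℝ) (by rw [h11]; exact hIder) hsder ?_
      intro r hr
      have hr' : 1 < r := hr
      simp only [mem_Ioi]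
      rw [lt_div_iff₀ (by linarith)]; linarith
    have hIpos : ∀ᶠ r in 𝓝[>] (1:ℝ), 0 < I (2 * r / (r + 1)) := by
      have hc := hIs.continuousWithinAt
      have h11 : (2 * (1:ℝ) / (1 + 1)) = 1 := by norm_num
      refine hc.eventually (lt_mem_nhds ?_)
      simp only [h11, hI1']; exact one_pos
    have hKpos : ∀ᶠ r in 𝓝[>] (1:ℝ), 0 < 1 + (r - 1) * K := by
      have hc : ContinuousWithinAt (fun r : ℝ => 1 + (r - 1) * K) (Ioi 1) 1 := by
        apply Continuous.continuousWithinAt; fun_prop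
      refine hc.eventually (lt_mem_nhds ?_)
      simp
    refine deriv_le_aux (fun r => Real.log (1 + (r - 1) * K))
      (fun r => n * (Real.log 2 + (r / 2) * Real.log r - (r + 1) / 2 * Real.log (r + 1)) +
        (r + 1) * Real.log (I (2 * r / (r + 1)))) K (-(n * Real.log 2 / 2) + m) 1 ?_ ?_ ?_ ?_
    · have : HasDerivAt (fun r : ℝ => 1 + (r - 1) * K) K 1 := by
        simpa using (((hasDerivAt_id (1:ℝ)).sub_const 1).mul_const K).const_add 1
      have := this.log (by simp)
      simpa using this.hasDerivWithinAt
    · have b1 : HasDerivAt (fun r : ℝ => n * (Real.log 2 + (r / 2) * Real.log r - (r + 1) / 2 * Real.log (r + 1)))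
          (-(n * Real.log 2 / 2)) 1 := by
        have c1 := ((hasDerivAt_id (1:ℝ)).div_const 2).mul (Real.hasDerivAt_log (one_ne_zero))
        have c0 := ((hasDerivAt_id (1:ℝ)).add_const 1)
        have c2 := (c0.div_const 2).mul (c0.log (by norm_num))
        exact (((c1.const_add (Real.log 2)).sub c2).const_mul (n:ℝ)).congr_deriv (by
          simp only [id, Real.log_one]
          norm_num
          ring)
      have b2 := ((hasDerivAt_id (1:ℝ)).add_const 1).hasDerivWithinAt (s := Ioi 1)
      have h11 : (2 * (1:ℝ) / (1 + 1)) = 1 := by norm_num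
      have b3 := b2.mul (hIs.log (by rw [h11, hI1']; exact one_ne_zero))
      exact (b1.hasDerivWithinAt.add b3).congr_deriv (by
        simp only [h11, hI1', Real.log_one, id]
        ring)
    · have h11 : (2 * (1:ℝ) / (1 + 1)) = 1 := by norm_num
      simp only [h11, hI1', Real.log_one]
      norm_num
    · filter_upwards [hIpos, hKpos, self_mem_nhdsWithin] with r hr1 hr2 hr3
      have hr : 1 < r := hr3
      have hr0 : 0 < r := by linarith
      have := Real.log_le_log hr2 (hJ r hr)
      refine this.trans (le_of_eq ?_)
      change Real.log (2 ^ n * (√(r / (r + 1)) ^ r * √(1 / (r + 1))) ^ n * (I (2 * r / (r + 1))) ^ (r + 1)) = _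
      rw [Real.log_mul (by positivity) (by positivity), Real.log_mul (by positivity) (by positivity),
        Real.log_pow, Real.log_pow, Real.log_rpow hr1, Real.log_mul (by positivity) (by positivity),
        Real.log_rpow (by positivity), Real.log_sqrt (by positivity), Real.log_sqrt (by positivity),
        Real.log_div (by positivity) (by positivity), Real.log_div (by positivity) (by positivity), Real.log_one]
      ring
  · -- upper bound
    have hd0 : d 0 = ∫ x, p x ^ 2 := by
      rw [hd]; simp only [zero_add, pow_two]
    have hL : Real.exp m ≤ d 0 := by
      have : Real.exp m = ∫ x, Real.exp m * ((1 - m) * p x + p x * Real.log (p x)) := by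
        rw [integral_const_mul, integral_add (hpi.const_mul _) h1, integral_const_mul, hpdf, ← hm]
        ring
      rw [this, hd0]
      refine integral_mono (((hpi.const_mul _).add h1).const_mul _) hp2 fun x => ?_
      rcases (hnn x).eq_or_lt with h | h
      · simp [← h]
      · have a := Real.add_one_le_exp (Real.log (p x) - m)
        rw [Real.exp_sub, Real.exp_log h, le_div_iff₀ (Real.exp_pos m)] at a
        simp only
        nlinarith
    have hd0p : 0 < d 0 := (Real.exp_pos m).trans_le hL
    have hmL : m ≤ Real.log (d 0) := (Real.le_log_iff_exp_le hd0p).2 hL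
    have hmain : ∀ᶠ e in 𝓝[>] (0:ℝ), (1 - e * K) * d 0 ^ e ≤ ((1 - e) ^ n)⁻¹ := by
      filter_upwards [Ioo_mem_nhdsGT (by norm_num : (0:ℝ) < 1)] with e he
      have ht0 : 0 < 1 - e := by linarith [he.2]
      have := upper_conv n q hq hq1 M hM hlcq D hD (1 - e) ht0 (by linarith [he.1])
      have h2 := (mul_le_mul_left (hlow (1 - e) ht0) (D 0 ^ (1 - (1 - e)))).trans this
      rw [_root_.sub_sub_cancel, hDd, ENNReal.ofReal_rpow_of_nonneg (hdnn 0) he.1.le,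
        ← ENNReal.ofReal_mul' (by positivity), ← ENNReal.ofReal_pow ht0.le,
        ← ENNReal.ofReal_inv_of_pos (by positivity), ENNReal.ofReal_le_ofReal_iff (by positivity)] at h2
      refine le_trans (le_of_eq ?_) h2
      ring
    have := deriv_le_aux (fun e => (1 - e * K) * d 0 ^ e) (fun e => ((1 - e) ^ n)⁻¹) (-K + Real.log (d 0)) n 0
      ?_ ?_ (by simp) hmain
    · linarith
    · have c1 : HasDerivAt (fun e : ℝ => 1 - e * K) (-K) 0 := by
        simpa using ((hasDerivAt_id (0:ℝ)).mul_const K).const_sub 1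
      have c2 := (Real.hasStrictDerivAt_const_rpow hd0p 0).hasDerivAt
      have c3 := (c1.mul c2).hasDerivWithinAt (s := Ioi 0)
      exact c3.congr_deriv (by simp)
    · have c1 : HasDerivAt (fun e : ℝ => 1 - e) (-1) 0 := by
        simpa using (hasDerivAt_id (0:ℝ)).const_sub 1
      have c2 := ((c1.pow n).inv (by simp)).hasDerivWithinAt (s := Ioi 0)
      exact c2.congr_deriv (by simp)

/-- For i.i.d. random vectors `X, Y` in ℝⁿ with log-concave density `p`,
the entropy powers satisfy `2 ≤ H(X−Y) / H(X) ≤ e²`, where `H(W) = exp (2 h(W) / n)`. -/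
theorem stmt_15 (n : ℕ) (hn : 0 < n) (p : (Fin n → ℝ) → ℝ)
    (hnn : ∀ x, 0 ≤ p x) (hpdf : ∫ x, p x = 1)
    (hlc : ∀ x y : Fin n → ℝ, ∀ t : ℝ, 0 ≤ t → t ≤ 1 →
      p x ^ t * p y ^ (1 - t) ≤ p (t • x + (1 - t) • y))
    (d : (Fin n → ℝ) → ℝ)
    (hd : d = fun x => ∫ y, p (x + y) * p y)
    (h1 : Integrable fun x => p x * Real.log (p x))
    (h3 : Integrable fun x => d x * Real.log (d x)) :
    2 ≤ Real.exp (2 * (-∫ x, d x * Real.log (d x)) / n) /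
          Real.exp (2 * (-∫ x, p x * Real.log (p x)) / n) ∧
    Real.exp (2 * (-∫ x, d x * Real.log (d x)) / n) /
          Real.exp (2 * (-∫ x, p x * Real.log (p x)) / n) ≤ Real.exp 2 := by
  obtain ⟨q, hq, hqnn, hqp, hqlc⟩ := regularize n p hnn hlc
  have e0 : ∫ x, q x = 1 := by rw [integral_congr_ae hqp, hpdf]
  have e1 : (fun x => q x * Real.log (q x)) =ᵐ[volume] fun x => p x * Real.log (p x) := by
    filter_upwards [hqp] with x hx
    rw [hx]
  have e2 : d = fun x => ∫ y, q (x + y) * q y := by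
    rw [hd]
    funext x
    apply integral_congr_ae
    have : ∀ᵐ y, q (x + y) = p (x + y) :=
      (measurePreserving_add_left volume x).quasiMeasurePreserving.ae hqp
    filter_upwards [hqp, this] with y hy hy2
    rw [hy, hy2]
  obtain ⟨c1, c2⟩ := core n q hq hqnn e0 hqlc d e2 (h1.congr e1.symm) h3
  rw [integral_congr_ae e1] at c1 c2
  have hn' : (0:ℝ) < n := by exact_mod_cast hn
  rw [← Real.exp_sub, ← sub_div]
  constructor
  · rw [← Real.exp_log (by norm_num : (0:ℝ) < 2), Real.exp_le_exp, Real.exp_log (by norm_num : (0:ℝ) < 2),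
      le_div_iff₀ hn']
    linarith
  · rw [Real.exp_le_exp, div_le_iff₀ hn']
    linarith
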